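/- arXiv:math/0110134 — 3 statements merged into one kernel-verified Lean document; each statement's English description precedes it below -/
import Mathlib

section
/- Let f : ℝ → ℝ be a C^∞ function with f ≥ 0, f not identically zero, and support contained in the interval (1/2, 1) (note 1 < π/2, so 1 + f(ψ) > |sin ψ| holds automatically). Then: R(α) = 0 for all α ∈ (0, 1/2]; R(α) > 0 for all α ∈ [1, π/2); there exists α′ ∈ [1, π/2) such that R is strictly decreasing on [α′, π/2); and consequently, for every nonzero integer k, the set { α ∈ [α′, π/2) : k·R(α) ∈ 2πℤ } is finite. -/
open Real Set Filter MeasureTheory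
open scoped BigOperators Topology

noncomputable section

/-- The conditions on the profile function `f` of the surface of revolution:
`f` is `C^∞` on `(−π/2, π/2)`, `f 0 = 0` and `1 + f ψ > |sin ψ|`. -/
def SurfaceFun (f : ℝ → ℝ) : Prop :=
  ContDiffOn ℝ (⊤ : ℕ∞) f (Set.Ioo (-(π / 2)) (π / 2)) ∧
  f 0 = 0 ∧
  ∀ ψ ∈ Set.Ioo (-(π / 2)) (π / 2), |Real.sin ψ| < 1 + f ψ

/-- `(θ, φ)` solves the Euler–Lagrange equations of the Lagrangian
`L = φ̇² cos²θ + θ̇² (1 + f θ)²` on the set `I`. -/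
def IsELGeodesicOn (f θ φ : ℝ → ℝ) (I : Set ℝ) : Prop :=
  ContDiff ℝ 2 θ ∧ ContDiff ℝ 2 φ ∧
  (∀ t ∈ I, deriv (fun s => deriv φ s * Real.cos (θ s) ^ 2) t = 0) ∧
  (∀ t ∈ I, deriv (deriv θ) t * (1 + f (θ t)) ^ 2
      + (deriv θ t) ^ 2 * (1 + f (θ t)) * deriv f (θ t)
      + (deriv φ t) ^ 2 * Real.cos (θ t) * Real.sin (θ t) = 0)

/-- `f̃(θ) = (f(θ) + f(−θ))/2`. -/
def tildeF (f : ℝ → ℝ) (θ : ℝ) : ℝ := (f θ + f (-θ)) / 2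

/-- The period `T_*(α)` of the latitude coordinate of a geodesic crossing the equator
at angle `α`. -/
def Tper (f : ℝ → ℝ) (α : ℝ) : ℝ :=
  2 * π + 2 * ∫ θ in (-α)..α,
    tildeF f θ * Real.cos θ / Real.sqrt (Real.cos θ ^ 2 - Real.cos α ^ 2)

/-- The angular shift `R(α)` (minus `2π`) over one latitude period. -/
def Rshift (f : ℝ → ℝ) (α : ℝ) : ℝ :=
  2 * Real.cos α * ∫ θ in (-α)..α,
    tildeF f θ / (Real.cos θ * Real.sqrt (Real.cos θ ^ 2 - Real.cos α ^ 2))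

lemma rs_cos_lt {α θ : ℝ} (hα : α ∈ Set.Ico (1 : ℝ) (π / 2)) (hθ : θ ∈ Set.Ioo (-1 : ℝ) 1) :
    0 < Real.cos α ∧ Real.cos α ≤ Real.cos 1 ∧ Real.cos 1 < Real.cos θ := by
  have hpi := Real.pi_gt_three
  refine ⟨Real.cos_pos_of_mem_Ioo ⟨by linarith [hα.1], hα.2⟩, ?_, ?_⟩
  · exact Real.cos_le_cos_of_nonneg_of_le_pi (by norm_num) (by linarith [hα.2]) hα.1
  · rw [← Real.cos_abs θ]
    exact Real.cos_lt_cos_of_nonneg_of_le_pi (abs_nonneg _) (by linarith)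
      (abs_lt.2 ⟨hθ.1, hθ.2⟩)

lemma rs_tilde_zero {f : ℝ → ℝ} (hsupp : Function.support f ⊆ Set.Ioo (1 / 2 : ℝ) 1)
    {θ : ℝ} (h : ¬ (θ ∈ Set.Ioo (1 / 2 : ℝ) 1 ∨ -θ ∈ Set.Ioo (1 / 2 : ℝ) 1)) :
    tildeF f θ = 0 := by
  push Not at h
  have h1 : f θ = 0 := by
    by_contra h'
    exact h.1 (hsupp h')
  have h2 : f (-θ) = 0 := by
    by_contra h'
    exact h.2 (hsupp h')
  simp [tildeF, h1, h2]

lemma rs_tilde_zero_of_not_mem {f : ℝ → ℝ}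
    (hsupp : Function.support f ⊆ Set.Ioo (1 / 2 : ℝ) 1)
    {θ : ℝ} (h : θ ∉ Set.Ioo (-1 : ℝ) 1) : tildeF f θ = 0 := by
  apply rs_tilde_zero hsupp
  rintro (h' | h')
  · exact h ⟨by linarith [h'.1], h'.2⟩
  · exact h ⟨by linarith [h'.2], by linarith [h'.1]⟩

def rsG (f : ℝ → ℝ) (α θ : ℝ) : ℝ :=
  tildeF f θ / (Real.cos θ * Real.sqrt (Real.cos θ ^ 2 - Real.cos α ^ 2))

lemma rs_bound {f : ℝ → ℝ} (hf : ContDiff ℝ (⊤ : ℕ∞) f)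
    (hsupp : Function.support f ⊆ Set.Ioo (1 / 2 : ℝ) 1) :
    ∃ C : ℝ, 0 ≤ C ∧ ∀ θ ∈ Set.Ioo (-1 : ℝ) 1,
      |f θ| ≤ C * (Real.cos θ ^ 2 - Real.cos 1 ^ 2) := by
  have hpi := Real.pi_gt_three
  obtain ⟨C, hC⟩ := (isCompact_Icc (a := (0 : ℝ)) (b := 1)).exists_bound_of_continuousOn
    (hf.continuous_deriv (by simp)).continuousOn
  have hC0 : 0 ≤ C := (norm_nonneg _).trans (hC 0 (by simp))
  have hf1 : f 1 = 0 := by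
    by_contra h'
    exact absurd (hsupp h').2 (lt_irrefl _)
  have hc1 : 0 < Real.cos 1 := Real.cos_pos_of_mem_Ioo ⟨by linarith, by linarith⟩
  have hα1 : (1 : ℝ) ∈ Set.Ico (1 : ℝ) (π / 2) := ⟨le_rfl, by linarith⟩
  refine ⟨C * (π ^ 2 / 2) / Real.cos 1, by positivity, fun θ hθ => ?_⟩
  obtain ⟨_, _, hlt⟩ := rs_cos_lt hα1 hθ
  have hsq : 0 ≤ Real.cos θ ^ 2 - Real.cos 1 ^ 2 := by nlinarith
  by_cases hm : θ ∈ Set.Ioo (1 / 2 : ℝ) 1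
  · have h1 : |f θ| ≤ C * (1 - θ) := by
      have := (convex_Icc (0 : ℝ) 1).norm_image_sub_le_of_norm_deriv_le (f := f) (C := C)
        (x := 1) (y := θ)
        (fun x _ => (hf.differentiable (by simp)).differentiableAt) hC (by simp)
        ⟨by linarith [hm.1], hm.2.le⟩
      rw [hf1, sub_zero, Real.norm_eq_abs, Real.norm_eq_abs, abs_sub_comm,
        abs_of_nonneg (by linarith [hm.2] : 0 ≤ 1 - θ)] at this
      exact this
    have h2 : 2 / π ^ 2 * (1 - θ) ≤ Real.cos θ - Real.cos 1 := by
      rw [Real.cos_sub_cos]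
      have a1 := Real.mul_le_sin (x := (1 + θ) / 2) (by linarith [hm.1]) (by linarith [hm.2])
      have a2 := Real.mul_le_sin (x := (1 - θ) / 2) (by linarith [hm.2]) (by linarith [hm.1])
      have e1 : -2 * Real.sin ((θ + 1) / 2) * Real.sin ((θ - 1) / 2)
          = 2 * (Real.sin ((1 + θ) / 2) * Real.sin ((1 - θ) / 2)) := by
        rw [show (θ - 1) / 2 = -((1 - θ) / 2) by ring, Real.sin_neg, add_comm θ 1]; ring
      rw [e1]
      have b1 : 0 ≤ 2 / π * ((1 - θ) / 2) :=
        mul_nonneg (by positivity) (by linarith [hm.2])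
      have b2 : 0 ≤ 2 / π * ((1 + θ) / 2) :=
        mul_nonneg (by positivity) (by linarith [hm.1])
      have := mul_le_mul a1 a2 b1 (b2.trans a1)
      have e2 : 2 / π * ((1 + θ) / 2) * (2 / π * ((1 - θ) / 2))
          = 1 / π ^ 2 * (1 - θ) * (1 + θ) := by field_simp
      rw [e2] at this
      have b3 : 0 ≤ 1 / π ^ 2 * (1 - θ) := mul_nonneg (by positivity) (by linarith [hm.2])
      have e3 : 2 / π ^ 2 * (1 - θ) = 2 * (1 / π ^ 2 * (1 - θ)) := by ring
      rw [e3]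
      nlinarith [hm.1]
    have h3 : (Real.cos θ - Real.cos 1) * Real.cos 1 ≤ Real.cos θ ^ 2 - Real.cos 1 ^ 2 := by
      nlinarith
    have h4 : 1 - θ ≤ π ^ 2 / 2 * (Real.cos θ - Real.cos 1) := by
      have := mul_le_mul_of_nonneg_left h2 (by positivity : 0 ≤ π ^ 2 / 2)
      have e : π ^ 2 / 2 * (2 / π ^ 2 * (1 - θ)) = 1 - θ := by field_simp
      linarith
    have h5 : Real.cos θ - Real.cos 1 ≤ (Real.cos θ ^ 2 - Real.cos 1 ^ 2) / Real.cos 1 := by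
      rwa [le_div_iff₀ hc1]
    calc |f θ| ≤ C * (1 - θ) := h1
      _ ≤ C * (π ^ 2 / 2 * ((Real.cos θ ^ 2 - Real.cos 1 ^ 2) / Real.cos 1)) := by
        refine mul_le_mul_of_nonneg_left (h4.trans ?_) hC0
        exact mul_le_mul_of_nonneg_left h5 (by positivity)
      _ = _ := by ring
  · have : f θ = 0 := by
      by_contra h'
      exact hm (hsupp h')
    rw [this, abs_zero]
    positivity

lemma rs_integrable {f : ℝ → ℝ} (hf : ContDiff ℝ (⊤ : ℕ∞) f)
    (hsupp : Function.support f ⊆ Set.Ioo (1 / 2 : ℝ) 1) {α : ℝ}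
    (hα : α ∈ Set.Ico (1 : ℝ) (π / 2)) : Integrable (rsG f α) := by
  obtain ⟨C, hC0, hC⟩ := rs_bound hf hsupp
  have hc := hf.continuous
  have hsub : Function.support (rsG f α) ⊆ Set.Ioo (-1 : ℝ) 1 := by
    intro θ hθ
    by_contra h
    exact hθ (by simp [rsG, rs_tilde_zero_of_not_mem hsupp h])
  have hmeas : Measurable (rsG f α) := by
    unfold rsG tildeF
    have := hc.measurable
    fun_prop
  rw [← integrableOn_iff_integrable_of_support_subset hsub]
  refine Measure.integrableOn_of_bounded (M := C / Real.cos 1) (by simp)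
    hmeas.aestronglyMeasurable ?_
  refine (ae_restrict_iff' measurableSet_Ioo).2 (Filter.Eventually.of_forall fun θ hθ => ?_)
  obtain ⟨h1, h2, h3⟩ := rs_cos_lt hα hθ
  have hθ' : -θ ∈ Set.Ioo (-1 : ℝ) 1 := ⟨by linarith [hθ.2], by linarith [hθ.1]⟩
  have hA := hC θ hθ
  have hB := hC (-θ) hθ'
  rw [Real.cos_neg] at hB
  have hT : |tildeF f θ| ≤ C * (Real.cos θ ^ 2 - Real.cos 1 ^ 2) := by
    unfold tildeF
    rw [abs_div, abs_two]
    linarith [abs_add_le (f θ) (f (-θ))]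
  have hle : Real.cos θ ^ 2 - Real.cos 1 ^ 2 ≤ Real.cos θ ^ 2 - Real.cos α ^ 2 := by nlinarith
  have hpos : 0 < Real.cos θ ^ 2 - Real.cos α ^ 2 := by nlinarith
  set s := Real.sqrt (Real.cos θ ^ 2 - Real.cos α ^ 2) with hs
  have hspos : 0 < s := Real.sqrt_pos.2 hpos
  have hs2 : s ^ 2 = Real.cos θ ^ 2 - Real.cos α ^ 2 := Real.sq_sqrt hpos.le
  have hs1 : s ≤ 1 := by
    rw [hs, Real.sqrt_le_one]
    nlinarith [Real.cos_sq_le_one θ, sq_nonneg (Real.cos α)]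
  have hcp : 0 < Real.cos 1 := by linarith
  unfold rsG
  rw [Real.norm_eq_abs, abs_div, abs_of_pos (mul_pos (by linarith) hspos),
    div_le_div_iff₀ (mul_pos (by linarith) hspos) hcp]
  have hT2 : |tildeF f θ| ≤ C * s := by
    refine hT.trans (mul_le_mul_of_nonneg_left ?_ hC0)
    nlinarith
  calc |tildeF f θ| * Real.cos 1 ≤ (C * s) * Real.cos θ :=
        mul_le_mul hT2 h3.le hcp.le (by positivity)
    _ = _ := by ring

lemma rs_eq {f : ℝ → ℝ} (hsupp : Function.support f ⊆ Set.Ioo (1 / 2 : ℝ) 1) {α : ℝ}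
    (hα : α ∈ Set.Ico (1 : ℝ) (π / 2)) :
    Rshift f α = ∫ θ, 2 * Real.cos α * rsG f α θ := by
  rw [integral_const_mul, Rshift]
  congr 1
  apply intervalIntegral.integral_eq_integral_of_support_subset (f := rsG f α)
  intro θ hθ
  have : θ ∈ Set.Ioo (-1 : ℝ) 1 := by
    by_contra h
    exact hθ (by simp [rsG, rs_tilde_zero_of_not_mem hsupp h])
  exact ⟨by linarith [hα.1, this.1], by linarith [hα.1, this.2]⟩

lemma rs_int_pos {f g : ℝ → ℝ} (hf : Continuous f)
    (hfne : f ≠ 0) (hg : Integrable g) (h0 : ∀ x, 0 ≤ g x)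
    (hpos : ∀ x, f x ≠ 0 → 0 < g x) : 0 < ∫ x, g x := by
  rw [integral_pos_iff_support_of_nonneg h0 hg]
  have hne : (Function.support f).Nonempty := Function.support_nonempty_iff.2 hfne
  have ho : IsOpen (Function.support f) := hf.isOpen_support
  exact (ho.measure_pos volume hne).trans_le (measure_mono fun x hx => (hpos x hx).ne')

lemma rs_tilde_nonneg {f : ℝ → ℝ} (h : ∀ x : ℝ, 0 ≤ f x) (θ : ℝ) : 0 ≤ tildeF f θ := by
  unfold tildeF; linarith [h θ, h (-θ)]

lemma rs_tilde_pos {f : ℝ → ℝ} (h : ∀ x : ℝ, 0 ≤ f x) {θ : ℝ} (hθ : f θ ≠ 0) :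
    0 < tildeF f θ := by
  unfold tildeF; linarith [lt_of_le_of_ne (h θ) hθ.symm, h (-θ)]

lemma rs_kernel_pos {α θ : ℝ} (hα : α ∈ Set.Ico (1 : ℝ) (π / 2))
    (hθ : θ ∈ Set.Ioo (-1 : ℝ) 1) :
    0 < 2 * Real.cos α / (Real.cos θ * Real.sqrt (Real.cos θ ^ 2 - Real.cos α ^ 2)) := by
  obtain ⟨h1, h2, h3⟩ := rs_cos_lt hα hθ
  have : 0 < Real.sqrt (Real.cos θ ^ 2 - Real.cos α ^ 2) := Real.sqrt_pos.2 (by nlinarith)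
  have : 0 < Real.cos θ := by linarith
  positivity

lemma rs_kernel_lt {α β θ : ℝ} (hα : α ∈ Set.Ico (1 : ℝ) (π / 2))
    (hβ : β ∈ Set.Ico (1 : ℝ) (π / 2)) (hab : α < β) (hθ : θ ∈ Set.Ioo (-1 : ℝ) 1) :
    2 * Real.cos β / (Real.cos θ * Real.sqrt (Real.cos θ ^ 2 - Real.cos β ^ 2)) <
    2 * Real.cos α / (Real.cos θ * Real.sqrt (Real.cos θ ^ 2 - Real.cos α ^ 2)) := by
  obtain ⟨h1, h2, h3⟩ := rs_cos_lt hα hθ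
  obtain ⟨k1, k2, k3⟩ := rs_cos_lt hβ hθ
  have hlt : Real.cos β < Real.cos α :=
    Real.cos_lt_cos_of_nonneg_of_le_pi (by linarith [hα.1])
      (by linarith [hβ.2, Real.pi_pos]) hab
  have hs : 0 < Real.sqrt (Real.cos θ ^ 2 - Real.cos α ^ 2) := Real.sqrt_pos.2 (by nlinarith)
  have hc : 0 < Real.cos θ := by linarith
  have hss : Real.sqrt (Real.cos θ ^ 2 - Real.cos α ^ 2)
      ≤ Real.sqrt (Real.cos θ ^ 2 - Real.cos β ^ 2) := Real.sqrt_le_sqrt (by nlinarith)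
  refine div_lt_div₀ (by linarith) ?_ (by linarith) (by positivity)
  exact mul_le_mul_of_nonneg_left hss hc.le

lemma rs_G_eq (f : ℝ → ℝ) (α θ : ℝ) : 2 * Real.cos α * rsG f α θ = tildeF f θ *
    (2 * Real.cos α / (Real.cos θ * Real.sqrt (Real.cos θ ^ 2 - Real.cos α ^ 2))) := by
  unfold rsG; ring

lemma rs_supp_mem {f : ℝ → ℝ} (hsupp : Function.support f ⊆ Set.Ioo (1 / 2 : ℝ) 1)
    {θ : ℝ} (h : f θ ≠ 0) : θ ∈ Set.Ioo (-1 : ℝ) 1 :=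
  ⟨by linarith [(hsupp h).1], (hsupp h).2⟩

/-- Properties of the angular shift `R(α)` for a nonnegative bump profile `f` supported in
`(1/2, 1)`: `R` vanishes on `(0, 1/2]`, is positive on `[1, π/2)`, is eventually strictly
decreasing, and consequently for each nonzero integer `k` the resonance set
`{α : k·R(α) ∈ 2πℤ}` is finite on the strictly decreasing range. -/
theorem Rshift_properties (f : ℝ → ℝ) (hf : ContDiff ℝ (⊤ : ℕ∞) f)
    (hfnonneg : ∀ x : ℝ, 0 ≤ f x) (hfne : f ≠ 0)
    (hsupp : Function.support f ⊆ Set.Ioo (1 / 2 : ℝ) 1) :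
    (∀ α ∈ Set.Ioc (0 : ℝ) (1 / 2), Rshift f α = 0) ∧
    (∀ α ∈ Set.Ico (1 : ℝ) (π / 2), 0 < Rshift f α) ∧
    ∃ α' ∈ Set.Ico (1 : ℝ) (π / 2),
      StrictAntiOn (Rshift f) (Set.Ico α' (π / 2)) ∧
      ∀ k : ℤ, k ≠ 0 →
        {α : ℝ | α ∈ Set.Ico α' (π / 2) ∧
          ∃ n : ℤ, (k : ℝ) * Rshift f α = 2 * π * (n : ℝ)}.Finite := by
  have hpi := Real.pi_gt_three
  have hP : ∀ α ∈ Set.Ico (1 : ℝ) (π / 2), 0 < Rshift f α := by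
    intro α hα
    rw [rs_eq hsupp hα]
    refine rs_int_pos hf.continuous hfne ((rs_integrable hf hsupp hα).const_mul _) ?_ ?_
    · intro θ
      rw [rs_G_eq]
      by_cases hθ : θ ∈ Set.Ioo (-1 : ℝ) 1
      · exact mul_nonneg (rs_tilde_nonneg hfnonneg θ) (rs_kernel_pos hα hθ).le
      · rw [rs_tilde_zero_of_not_mem hsupp hθ, zero_mul]
    · intro θ h
      rw [rs_G_eq]
      exact mul_pos (rs_tilde_pos hfnonneg h) (rs_kernel_pos hα (rs_supp_mem hsupp h))
  have hA : StrictAntiOn (Rshift f) (Set.Ico (1 : ℝ) (π / 2)) := by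
    intro α hα β hβ hab
    rw [rs_eq hsupp hα, rs_eq hsupp hβ, ← sub_pos]
    have iα := (rs_integrable hf hsupp hα).const_mul (2 * Real.cos α)
    have iβ := (rs_integrable hf hsupp hβ).const_mul (2 * Real.cos β)
    rw [← integral_sub iα iβ]
    refine rs_int_pos hf.continuous hfne (iα.sub iβ) ?_ ?_
    · intro θ
      rw [rs_G_eq, rs_G_eq, ← mul_sub]
      by_cases hθ : θ ∈ Set.Ioo (-1 : ℝ) 1
      · exact mul_nonneg (rs_tilde_nonneg hfnonneg θ)
          (sub_nonneg.2 (rs_kernel_lt hα hβ hab hθ).le)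
      · rw [rs_tilde_zero_of_not_mem hsupp hθ, zero_mul]
    · intro θ h
      rw [rs_G_eq, rs_G_eq, ← mul_sub]
      exact mul_pos (rs_tilde_pos hfnonneg h)
        (sub_pos.2 (rs_kernel_lt hα hβ hab (rs_supp_mem hsupp h)))
  refine ⟨?_, hP, 1, ⟨le_rfl, by linarith⟩, hA, ?_⟩
  · intro α hα
    unfold Rshift
    rw [intervalIntegral.integral_zero_ae, mul_zero]
    refine Filter.Eventually.of_forall fun θ hθ => ?_
    rw [Set.uIoc_of_le (by linarith [hα.1])] at hθ
    rw [rs_tilde_zero hsupp, zero_div]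
    rintro (h | h)
    · linarith [h.1, hθ.2, hα.2]
    · linarith [h.1, hθ.1, hα.2]
  · intro k hk
    have hk' : (k : ℝ) ≠ 0 := by exact_mod_cast hk
    have h1 : (1 : ℝ) ∈ Set.Ico (1 : ℝ) (π / 2) := ⟨le_rfl, by linarith⟩
    obtain ⟨N, hN⟩ := exists_nat_gt (|(k : ℝ)| * Rshift f 1)
    refine Set.Finite.of_finite_image (f := fun α => (k : ℝ) * Rshift f α)
      (((Set.finite_Icc (-(N : ℤ)) N).image (fun n : ℤ => 2 * π * (n : ℝ))).subset ?_) ?_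
    · rintro _ ⟨α, ⟨hα, n, hn⟩, rfl⟩
      refine ⟨n, ?_, hn.symm⟩
      have hle : Rshift f α ≤ Rshift f 1 := hA.antitoneOn h1 hα hα.1
      have h2 : |2 * π * (n : ℝ)| ≤ N := by
        rw [← hn, abs_mul, abs_of_pos (hP α hα)]
        exact (mul_le_mul_of_nonneg_left hle (abs_nonneg _)).trans hN.le
      rw [abs_mul, abs_of_pos (by positivity : 0 < 2 * π)] at h2
      have h3 : |(n : ℝ)| ≤ N := by nlinarith [abs_nonneg (n : ℝ)]
      have h4 := abs_le.1 h3
      exact ⟨by exact_mod_cast h4.1, by exact_mod_cast h4.2⟩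
    · intro α hα β hβ h
      exact hA.injOn hα.1 hβ.1 (mul_left_cancel₀ hk' h)
end
end

section
/- Let (m_n) be a regular sequence with Σ_{n=1}^∞ m_n^{−1/n} < ∞ (so the class C(m_n) is not quasianalytic). Then there exists a C^∞ function f : ℝ → ℝ such that f ≥ 0, f is not identically zero, the support of f is contained in the interval (1/2, 1), and f belongs to the Carleman class C(m_n, D) for every bounded open set D ⊆ ℝ. -/
open Real Set Filter MeasureTheory
open scoped BigOperators Topology

noncomputable section

/-- A sequence `(m n)` (indexed from 1) of positive reals is *regular* if it is nondecreasing,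
grows faster than any power of `n`, satisfies `m (n+1) / m n ≤ n * C ^ n`, and
`n ↦ log (m n / n!)` is convex. -/
def RegularSeq (m : ℕ → ℝ) : Prop :=
  (∀ n : ℕ, 1 ≤ n → 0 < m n) ∧
  (∀ n : ℕ, 1 ≤ n → m n ≤ m (n + 1)) ∧
  (∀ k : ℕ, Filter.Tendsto (fun n : ℕ => m n / (n : ℝ) ^ k) Filter.atTop Filter.atTop) ∧
  (∃ C : ℝ, 0 < C ∧ ∀ n : ℕ, 1 ≤ n → m (n + 1) / m n ≤ (n : ℝ) * C ^ n) ∧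
  (∀ n : ℕ, 1 ≤ n →
    Real.log (m (n + 1) / (Nat.factorial (n + 1) : ℝ)) ≤
      (Real.log (m n / (Nat.factorial n : ℝ)) +
        Real.log (m (n + 2) / (Nat.factorial (n + 2) : ℝ))) / 2)

/-- `u` belongs to the Carleman class `C(m_n, D)`: it is `C^∞` on `D` and there is `C > 0`
with `‖∂^α u‖ ≤ C^{|α|} m_{|α|}` on `D` for every order `|α| ≥ 1`. -/
def CarlemanClass {E F : Type*} [NormedAddCommGroup E] [NormedSpace ℝ E]
    [NormedAddCommGroup F] [NormedSpace ℝ F]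
    (m : ℕ → ℝ) (D : Set E) (u : E → F) : Prop :=
  ContDiffOn ℝ (⊤ : ℕ∞) u D ∧
  ∃ C : ℝ, 0 < C ∧ ∀ n : ℕ, 1 ≤ n → ∀ x ∈ D,
    ‖iteratedFDerivWithin ℝ n u D x‖ ≤ C ^ n * m n

namespace Bump

/-- averaging operator -/
def A (a : ℝ) (g : ℝ → ℝ) (x : ℝ) : ℝ := ∫ t in (0:ℝ)..1, g (x - a * t)

lemma A_hasDeriv {a : ℝ} (ha : 0 < a) {g : ℝ → ℝ} (hg : Continuous g) (x : ℝ) :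
    HasDerivAt (A a g) ((g x - g (x - a)) / a) x := by
  have h1 : A a g = fun x => a⁻¹ * ((∫ t in (0:ℝ)..x, g t) - ∫ t in (0:ℝ)..(x - a), g t) := by
    funext x
    unfold A
    rw [intervalIntegral.integral_comp_sub_mul g ha.ne' x]
    rw [intervalIntegral.integral_interval_sub_left (hg.intervalIntegrable _ _)
      (hg.intervalIntegrable _ _)]
    simp
  rw [h1]
  have h2 : ∀ y, HasDerivAt (fun x => ∫ t in (0:ℝ)..x, g t) (g y) y := fun y =>
    intervalIntegral.integral_hasDerivAt_right (hg.intervalIntegrable _ _)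
      (hg.stronglyMeasurableAtFilter _ _) hg.continuousAt
  have h3 : HasDerivAt (fun x => ∫ t in (0:ℝ)..(x - a), g t) (g (x - a)) x := by
    have := (h2 (x - a)).comp_sub_const x a
    exact this
  have := ((h2 x).sub h3).const_mul a⁻¹
  rw [div_eq_inv_mul]
  exact this

/-- 1-Lipschitz -/
def Lip (g : ℝ → ℝ) : Prop := ∀ x y, |g x - g y| ≤ |x - y|

lemma Lip.cont {g : ℝ → ℝ} (h : Lip g) : Continuous g := by
  have : LipschitzWith 1 g := LipschitzWith.of_dist_le_mul (fun x y => by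
    simpa [Real.dist_eq] using h x y)
  exact this.continuous

lemma int_bound {h : ℝ → ℝ} {c : ℝ} (hb : ∀ t, 0 ≤ t → t ≤ 1 → |h t| ≤ c) :
    |∫ t in (0:ℝ)..1, h t| ≤ c := by
  have := intervalIntegral.norm_integral_le_of_norm_le_const (a := 0) (b := 1) (f := h) (C := c)
    (fun t ht => by
      rw [Set.uIoc_of_le zero_le_one] at ht
      exact hb t ht.1.le ht.2)
  simpa using this

lemma ii {g : ℝ → ℝ} (hg : Continuous g) (a x : ℝ) :
    IntervalIntegrable (fun t => g (x - a * t)) volume 0 1 := by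
  apply Continuous.intervalIntegrable
  fun_prop

lemma A_lip {a : ℝ} {g : ℝ → ℝ} (h : Lip g) : Lip (A a g) := by
  intro x y
  unfold A
  rw [← intervalIntegral.integral_sub (ii h.cont a x) (ii h.cont a y)]
  apply int_bound
  intro t _ _
  refine (h _ _).trans (le_of_eq ?_)
  congr 1
  ring

lemma A_dist {a c : ℝ} {g h : ℝ → ℝ} (hg : Continuous g) (hh : Continuous h)
    (hd : ∀ x, |g x - h x| ≤ c) (x : ℝ) : |A a g x - A a h x| ≤ c := by
  unfold A
  rw [← intervalIntegral.integral_sub (ii hg a x) (ii hh a x)]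
  exact int_bound fun t _ _ => hd _

lemma A_self {a : ℝ} (ha : 0 < a) {g : ℝ → ℝ} (h : Lip g) (x : ℝ) : |A a g x - g x| ≤ a := by
  have : A a g x - g x = ∫ t in (0:ℝ)..1, (g (x - a * t) - g x) := by
    rw [intervalIntegral.integral_sub (ii h.cont a x) (by simp)]
    simp [A]
  rw [this]
  apply int_bound
  intro t h0 h1
  refine (h _ _).trans ?_
  rw [show x - a * t - x = -(a * t) by ring, abs_neg, abs_of_nonneg (by positivity)]
  nlinarith

/-- tent -/
def G (x : ℝ) : ℝ := max 0 (1/16 - |x - 3/4|)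

lemma G_lip : Lip G := by
  intro x y
  unfold G
  refine (abs_max_sub_max_le_max _ _ _ _).trans ?_
  simp only [sub_self, abs_zero]
  apply max_le (abs_nonneg _)
  rw [show (1/16 - |x - 3/4|) - (1/16 - |y - 3/4|) = |y - 3/4| - |x - 3/4| by ring]
  refine (abs_abs_sub_abs_le_abs_sub _ _).trans ?_
  rw [abs_sub_comm x y]
  apply le_of_eq
  congr 1
  ring

def sh (a : ℕ → ℝ) : ℕ → ℝ := fun n => a (n + 1)

def U : ℕ → (ℕ → ℝ) → ℝ → ℝ
  | 0, _ => G
  | n + 1, a => A (a 0) (U n (sh a))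

lemma U_lip (n : ℕ) : ∀ a, Lip (U n a) := by
  induction n with
  | zero => exact fun _ => G_lip
  | succ n ih => exact fun a => A_lip (ih _)

lemma U_nonneg (n : ℕ) : ∀ a x, 0 ≤ U n a x := by
  induction n with
  | zero => exact fun _ x => le_max_left _ _
  | succ n ih =>
    intro a x
    exact intervalIntegral.integral_nonneg zero_le_one fun t _ => ih _ _

lemma U_le (n : ℕ) : ∀ a x, |U n a x| ≤ 1 := by
  induction n with
  | zero =>
    intro _ x
    show |G x| ≤ 1
    unfold G
    rw [abs_of_nonneg (le_max_left _ _)]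
    apply max_le zero_le_one
    have := abs_nonneg (x - 3/4)
    linarith
  | succ n ih =>
    intro a x
    exact int_bound fun t _ _ => ih _ _

lemma U_step (n : ℕ) : ∀ a, (∀ j, 0 < a j) → ∀ x, |U (n+1) a x - U n a x| ≤ a n := by
  induction n with
  | zero => exact fun a ha x => A_self (ha 0) G_lip x
  | succ n ih =>
    intro a ha x
    exact A_dist (U_lip _ _).cont (U_lip _ _).cont (ih (sh a) fun j => ha _) x

lemma U_supp (n : ℕ) : ∀ a, (∀ j, 0 < a j) → ∀ x,
    (x ≤ 11/16 ∨ 13/16 + ∑ j ∈ Finset.range n, a j ≤ x) → U n a x = 0 := by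
  induction n with
  | zero =>
    intro a ha x hx
    show G x = 0
    unfold G
    apply max_eq_left
    simp only [Finset.range_zero, Finset.sum_empty, add_zero] at hx
    rcases hx with hx | hx
    · have := neg_abs_le (x - 3/4)
      linarith
    · have := le_abs_self (x - 3/4)
      linarith
  | succ n ih =>
    intro a ha x hx
    have : ∀ t, 0 ≤ t → t ≤ 1 → |U n (sh a) (x - a 0 * t)| ≤ 0 := by
      intro t h0 h1
      rw [ih (sh a) (fun j => ha _) _ ?_]
      · simp
      have := ha 0
      rw [Finset.sum_range_succ'] at hx
      rcases hx with hx | hx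
      · left; nlinarith
      · right
        show 13/16 + ∑ j ∈ Finset.range n, a (j+1) ≤ _
        nlinarith
    have := int_bound this
    exact abs_eq_zero.mp (le_antisymm this (abs_nonneg _))

def Good (a : ℕ → ℝ) : Prop := (∀ j, 0 < a j) ∧ Summable a

lemma Good.sh {a} (h : Good a) : Good (sh a) :=
  ⟨fun j => h.1 _, (summable_nat_add_iff 1).2 h.2⟩

def V (a : ℕ → ℝ) (x : ℝ) : ℝ := limUnder atTop (fun n => U n a x)

lemma V_tendsto {a} (h : Good a) (x : ℝ) : Tendsto (fun n => U n a x) atTop (𝓝 (V a x)) := by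
  have : CauchySeq (fun n => U n a x) := by
    apply cauchySeq_of_dist_le_of_summable a _ h.2
    intro n
    rw [dist_comm, Real.dist_eq]
    exact U_step n a h.1 x
  exact this.tendsto_limUnder

lemma V_lip {a} (h : Good a) : Lip (V a) := fun x y =>
  le_of_tendsto ((V_tendsto h x).sub (V_tendsto h y)).abs (Eventually.of_forall fun n => U_lip n a x y)

lemma V_nonneg {a} (h : Good a) (x) : 0 ≤ V a x :=
  ge_of_tendsto (V_tendsto h x) (Eventually.of_forall fun n => U_nonneg n a x)

lemma V_le {a} (h : Good a) (x) : |V a x| ≤ 1 :=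
  le_of_tendsto (V_tendsto h x).abs (Eventually.of_forall fun n => U_le n a x)

lemma V_G {a} (h : Good a) (x) : |G x - V a x| ≤ ∑' j, a j := by
  have := dist_le_tsum_of_dist_le_of_tendsto₀ (f := fun n => U n a x) a (fun n => by
    rw [dist_comm, Real.dist_eq]
    exact U_step n a h.1 x) h.2 (V_tendsto h x)
  exact this

lemma V_supp {a} (h : Good a) (x) (hx : x ≤ 11/16 ∨ 13/16 + ∑' j, a j ≤ x) : V a x = 0 := by
  refine tendsto_nhds_unique (V_tendsto h x) ?_
  have : (fun n => U n a x) = fun _ => 0 := by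
    funext n
    apply U_supp n a h.1
    refine hx.imp_right fun h1 => le_trans ?_ h1
    have := h.2.sum_le_tsum (Finset.range n) fun j _ => (h.1 j).le
    linarith
  rw [this]
  exact tendsto_const_nhds

lemma V_eq {a} (h : Good a) : V a = A (a 0) (V (sh a)) := by
  funext x
  have h1 : Tendsto (fun n => U (n+1) a x) atTop (𝓝 (V a x)) :=
    (tendsto_add_atTop_iff_nat 1).2 (V_tendsto h x)
  refine tendsto_nhds_unique h1 ?_
  show Tendsto (fun n => ∫ t in (0:ℝ)..1, U n (sh a) (x - a 0 * t)) atTop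
    (𝓝 (∫ t in (0:ℝ)..1, V (sh a) (x - a 0 * t)))
  apply intervalIntegral.tendsto_integral_filter_of_dominated_convergence (fun _ => (1:ℝ))
  · refine Eventually.of_forall fun n => ?_
    have := (U_lip n (sh a)).cont
    exact Continuous.aestronglyMeasurable (by fun_prop)
  · refine Eventually.of_forall fun n => Eventually.of_forall fun t _ => U_le _ _ _
  · simp
  · exact Eventually.of_forall fun t _ => V_tendsto h.sh _

lemma V_hasDeriv {a} (h : Good a) (x : ℝ) :
    HasDerivAt (V a) ((V (sh a) x - V (sh a) (x - a 0)) / a 0) x := by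
  have := A_hasDeriv (h.1 0) (V_lip h.sh).cont x
  rwa [← V_eq h] at this

lemma V_deriv {a} (h : Good a) :
    deriv (V a) = fun x => (a 0)⁻¹ * (V (sh a) x - V (sh a) (x - a 0)) := by
  funext x
  rw [(V_hasDeriv h x).deriv, div_eq_inv_mul]

lemma V_contDiff (n : ℕ) : ∀ a, Good a → ContDiff ℝ n (V a) := by
  induction n with
  | zero => exact fun a h => contDiff_zero.2 (V_lip h).cont
  | succ n ih =>
    intro a h
    push_cast
    rw [contDiff_succ_iff_deriv]
    refine ⟨fun x => (V_hasDeriv h x).differentiableAt, by simp, ?_⟩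
    rw [V_deriv h]
    have := ih _ h.sh
    fun_prop

lemma V_bound (n : ℕ) : ∀ a, Good a → ∀ x,
    |iteratedDeriv n (V a) x| ≤ 2 ^ n * (∏ j ∈ Finset.range n, a j)⁻¹ := by
  induction n with
  | zero =>
    intro a h x
    simpa using V_le h x
  | succ n ih =>
    intro a h x
    have hc := V_contDiff n _ h.sh
    rw [iteratedDeriv_succ', V_deriv h]
    have e : iteratedDeriv n (fun x => (a 0)⁻¹ * (V (sh a) x - V (sh a) (x - a 0))) x
      = (a 0)⁻¹ * (iteratedDeriv n (V (sh a)) x - iteratedDeriv n (V (sh a)) (x - a 0)) := by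
      have hc2 : ContDiff ℝ n (fun x => V (sh a) (x - a 0)) := by fun_prop
      rw [iteratedDeriv_const_mul_field]
      rw [iteratedDeriv_fun_sub hc.contDiffAt hc2.contDiffAt, iteratedDeriv_comp_sub_const]
    rw [e, abs_mul, Finset.prod_range_succ', abs_of_pos (inv_pos.2 (h.1 0)), mul_inv]
    have h1 := ih _ h.sh x
    have h2 := ih _ h.sh (x - a 0)
    have h3 := abs_sub (iteratedDeriv n (V (sh a)) x) (iteratedDeriv n (V (sh a)) (x - a 0))
    have h4 : |iteratedDeriv n (V (sh a)) x - iteratedDeriv n (V (sh a)) (x - a 0)| ≤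
      2 ^ (n+1) * (∏ j ∈ Finset.range n, a (j+1))⁻¹ := by
      rw [pow_succ]
      change _ ≤ 2 ^ n * (∏ j ∈ Finset.range n, a (j+1))⁻¹ at h1
      change _ ≤ 2 ^ n * (∏ j ∈ Finset.range n, a (j+1))⁻¹ at h2
      linarith
    have := mul_le_mul_of_nonneg_left h4 (inv_pos.2 (h.1 0)).le
    linarith

lemma m_sq {m : ℕ → ℝ} (hm : RegularSeq m) (n : ℕ) (hn : 1 ≤ n) :
    m (n+1) * m (n+1) ≤ m n * m (n+2) := by
  obtain ⟨hpos, -, -, -, hconv⟩ := hm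
  have p0 := hpos n hn
  have p1 := hpos (n+1) (by omega)
  have p2 := hpos (n+2) (by omega)
  have h := hconv n hn
  have f0 : (0:ℝ) < (n.factorial : ℝ) := by positivity
  have f1 : (0:ℝ) < ((n+1).factorial : ℝ) := by positivity
  have f2 : (0:ℝ) < ((n+2).factorial : ℝ) := by positivity
  have h' : Real.log ((m (n+1) / (n+1).factorial) * (m (n+1) / (n+1).factorial)) ≤
      Real.log ((m n / n.factorial) * (m (n+2) / (n+2).factorial)) := by
    rw [Real.log_mul (by positivity) (by positivity), Real.log_mul (by positivity) (by positivity)]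
    linarith
  rw [Real.log_le_log_iff (by positivity) (by positivity)] at h'
  rw [div_mul_div_comm, div_mul_div_comm, div_le_div_iff₀ (by positivity) (by positivity)] at h'
  have e : ((n+1).factorial : ℝ) * (n+1).factorial ≤ n.factorial * (n+2).factorial := by
    have e1 : ((n+1).factorial : ℝ) = (n+1) * n.factorial := by
      rw [Nat.factorial_succ]; push_cast; ring
    have e2 : ((n+2).factorial : ℝ) = (n+2) * (n+1).factorial := by
      rw [Nat.factorial_succ (n+1)]; push_cast; ring
    rw [e2]
    nth_rewrite 1 [e1]
    have : 0 < (n.factorial : ℝ) * (n+1).factorial := by positivity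
    nlinarith
  have q : 0 < (n.factorial : ℝ) * (n+2).factorial := by positivity
  have h3 : m (n+1) * m (n+1) * ((n.factorial : ℝ) * (n+2).factorial) ≤
      m n * m (n+2) * ((n.factorial : ℝ) * (n+2).factorial) :=
    h'.trans (mul_le_mul_of_nonneg_left e (by positivity))
  exact le_of_mul_le_mul_right h3 q

def s (m : ℕ → ℝ) (j : ℕ) : ℝ := m (j+1) / m (j+2)

lemma s_pos {m : ℕ → ℝ} (hm : RegularSeq m) (j : ℕ) : 0 < s m j :=
  div_pos (hm.1 _ (by omega)) (hm.1 _ (by omega))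

lemma s_prod {m : ℕ → ℝ} (hm : RegularSeq m) (n : ℕ) :
    ∏ j ∈ Finset.range n, s m j = m 1 / m (n+1) := by
  induction n with
  | zero =>
    have := hm.1 1 le_rfl
    simp [this.ne']
  | succ n ih =>
    rw [Finset.prod_range_succ, ih, s]
    have := hm.1 (n+1) (by omega)
    field_simp
    
lemma s_anti {m : ℕ → ℝ} (hm : RegularSeq m) : Antitone (s m) := by
  apply antitone_nat_of_succ_le
  intro j
  unfold s
  rw [div_le_div_iff₀ (hm.1 _ (by omega)) (hm.1 _ (by omega))]
  exact m_sq hm (j+1) (by omega)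

lemma s_pow {m : ℕ → ℝ} (hm : RegularSeq m) (j : ℕ) : s m j ^ (j+1) ≤ m 1 / m (j+2) := by
  rw [← s_prod hm (j+1)]
  have := Finset.prod_le_prod (s := Finset.range (j+1)) (f := fun _ => s m j) (g := s m)
    (fun i _ => (s_pos hm j).le) (fun i hi => s_anti hm (by
      have := Finset.mem_range.1 hi
      omega))
  simpa using this

lemma s_summable {m : ℕ → ℝ} (hm : RegularSeq m)
    (hnqa : Summable (fun n : ℕ => (m (n + 1)) ^ (-(1 : ℝ) / (n + 1 : ℝ)))) :
    Summable (s m) := by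
  have h1 := ((summable_nat_add_iff 1).2 hnqa).mul_left (max 1 (m 1))
  refine Summable.of_norm_bounded_eventually_nat h1 ?_
  have ht : Tendsto m atTop atTop := by simpa using hm.2.2.1 0
  have ht2 := (tendsto_add_atTop_iff_nat 2).2 ht
  filter_upwards [ht2.eventually_ge_atTop 1] with j hj
  rw [Real.norm_of_nonneg (s_pos hm j).le]
  have hM : 0 < m (j+2) := by linarith
  refine le_of_pow_le_pow_left₀ (n := j+1) (by omega) ?_ ?_
  · apply mul_nonneg (by positivity)
    exact Real.rpow_nonneg hM.le _
  refine (s_pow hm j).trans ?_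
  rw [mul_pow, div_eq_mul_inv]
  apply mul_le_mul
  · exact (le_max_right _ _).trans (le_self_pow₀ (le_max_left _ _) (by omega))
  · show _ ≤ (m (j+2) ^ (-(1:ℝ) / (((j+1 : ℕ) : ℝ) + 1))) ^ (j+1)
    rw [← Real.rpow_natCast, ← Real.rpow_mul hM.le, ← Real.rpow_neg_one]
    apply Real.rpow_le_rpow_of_exponent_le hj
    push_cast
    rw [div_mul_eq_mul_div, le_div_iff₀ (by positivity)]
    linarith
  · exact (inv_pos.2 hM).le
  · positivity

end Bump

open Bump in
/-- A nonquasianalytic Carleman class contains a nontrivial nonnegative bump function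
supported in `(1/2, 1)`. -/
theorem nonquasianalytic_contains_bump (m : ℕ → ℝ) (hm : RegularSeq m)
    (hnqa : Summable (fun n : ℕ => (m (n + 1)) ^ (-(1 : ℝ) / (n + 1 : ℝ)))) :
    ∃ f : ℝ → ℝ, ContDiff ℝ (⊤ : ℕ∞) f ∧ (∀ x : ℝ, 0 ≤ f x) ∧ f ≠ 0 ∧
      Function.support f ⊆ Set.Ioo (1 / 2 : ℝ) 1 ∧
      ∀ D : Set ℝ, IsOpen D → Bornology.IsBounded D → CarlemanClass m D f := by
  have hs := s_summable hm hnqa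
  have hT : 0 < ∑' j, s m j := hs.tsum_pos (fun j => (s_pos hm j).le) 0 (s_pos hm 0)
  obtain ⟨c, hc, hcT⟩ : ∃ c : ℝ, 0 < c ∧ c * ∑' j, s m j = 1/32 :=
    ⟨1/32 / ∑' j, s m j, by positivity, by field_simp⟩
  have hg : Good (fun j => c * s m j) := ⟨fun j => mul_pos hc (s_pos hm j), hs.mul_left c⟩
  have hsum : ∑' j, c * s m j = 1/32 := by rw [tsum_mul_left, hcT]
  have hsm : ContDiff ℝ (⊤ : ℕ∞) (V (fun j => c * s m j)) :=
    contDiff_infty.2 fun n => V_contDiff n _ hg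
  refine ⟨V (fun j => c * s m j), hsm, V_nonneg hg, ?_, ?_, ?_⟩
  · intro h0
    have h1 := V_G hg (3/4)
    rw [h0, hsum] at h1
    norm_num [G] at h1
  · intro x hx
    by_contra hx2
    apply hx
    apply V_supp hg
    rw [hsum]
    by_contra! h
    exact hx2 ⟨by linarith, by linarith⟩
  · intro D hD _
    refine ⟨hsm.contDiffOn, ?_⟩
    obtain ⟨K, hK, hKm⟩ := hm.2.2.2.1
    have hm1 := hm.1 1 le_rfl
    refine ⟨4 * K / c * max 1 (m 1)⁻¹, by positivity, fun n hn x hx => ?_⟩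
    rw [iteratedFDerivWithin_of_isOpen n hD hx, norm_iteratedFDeriv_eq_norm_iteratedDeriv,
      Real.norm_eq_abs]
    refine (V_bound n _ hg x).trans ?_
    rw [Finset.prod_mul_distrib, s_prod hm, Finset.prod_const, Finset.card_range]
    have hmn := hm.1 n hn
    have h1 := hKm n hn
    rw [div_le_iff₀ hmn] at h1
    have h2 : (n:ℝ) ≤ 2 ^ n := by exact_mod_cast Nat.lt_two_pow_self.le
    have h3 : m (n+1) ≤ 2 ^ n * K ^ n * m n := by
      refine h1.trans ?_
      gcongr
    have h4 : (m 1)⁻¹ ≤ (max 1 (m 1)⁻¹) ^ n :=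
      (le_max_right _ _).trans (le_self_pow₀ (le_max_left _ _) (by omega))
    have hmn1 := hm.1 (n+1) (by omega)
    calc 2 ^ n * (c ^ n * (m 1 / m (n+1)))⁻¹
        = 2 ^ n / c ^ n * ((m 1)⁻¹ * m (n+1)) := by field_simp
      _ ≤ 2 ^ n / c ^ n * ((max 1 (m 1)⁻¹) ^ n * (2 ^ n * K ^ n * m n)) := by gcongr
      _ = _ := by
        rw [mul_pow, div_pow, mul_pow, show (4:ℝ) = 2 * 2 by norm_num, mul_pow]
        ring
end
end

section
/- Let (m_n) be a regular sequence with Σ_{n=1}^∞ m_n^{−1/n} = ∞ (so the class C(m_n) is quasianalytic), and let h be a homogeneous Hamiltonian on T'ℝ^d which belongs to C(m_n, D) for every open set D with compact closure contained in T'ℝ^d, and whose flow Φ is complete. For T > 0 let Π^a_T denote the set of absolutely T-periodic points of T'ℝ^d, and let Π^a := ∪_{T>0} Π^a_T. If Ω is a path-connected subset of Π^a, then for every T > 0 either Ω ∩ Π^a_T = ∅ or Ω ⊆ Π^a_T. -/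
open Real Set Filter MeasureTheory
open scoped BigOperators Topology

noncomputable section

/-- The phase space `ℝ^d × ℝ^d`. -/
abbrev Phase (d : ℕ) := (Fin d → ℝ) × (Fin d → ℝ)

/-- `T'ℝ^d = ℝ^d × (ℝ^d ∖ {0})`. -/
def Tprime (d : ℕ) : Set (Phase d) := {p | p.2 ≠ 0}

/-- The Hamiltonian vector field `(∂h/∂ξ, −∂h/∂x)` of `h`. -/
def hamField {d : ℕ} (h : Phase d → ℝ) (p : Phase d) : Phase d :=
  (fun j => fderiv ℝ h p (0, Pi.single j 1), fun j => - fderiv ℝ h p (Pi.single j 1, 0))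

/-- `γ` solves Hamilton's equations `ẋ = h_ξ`, `ξ̇ = −h_x` on the set `I`. -/
def IsHamTrajOn {d : ℕ} (h : Phase d → ℝ) (γ : ℝ → Phase d) (I : Set ℝ) : Prop :=
  ∀ t ∈ I, HasDerivAt γ (hamField h (γ t)) t

/-- `h` is a homogeneous Hamiltonian: smooth and positive on `T'ℝ^d`, and positively
homogeneous of degree 1 in `ξ`. -/
def HomHamiltonian {d : ℕ} (h : Phase d → ℝ) : Prop :=
  ContDiffOn ℝ (⊤ : ℕ∞) h (Tprime d) ∧
  (∀ p ∈ Tprime d, 0 < h p) ∧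
  (∀ p ∈ Tprime d, ∀ c : ℝ, 0 < c → h (p.1, c • p.2) = c * h p)

/-- `Φ` is the complete flow of `h` on `T'ℝ^d`: it is smooth in `(t, y, η)`, starts at the
identity, stays in `T'ℝ^d`, solves Hamilton's equations for all time, and is the unique such
trajectory through each point. -/
def IsCompleteFlow {d : ℕ} (h : Phase d → ℝ) (Φ : ℝ → Phase d → Phase d) : Prop :=
  ContDiffOn ℝ (⊤ : ℕ∞) (fun q : ℝ × Phase d => Φ q.1 q.2) (Set.univ ×ˢ Tprime d) ∧
  ∀ p ∈ Tprime d,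
    Φ 0 p = p ∧ (∀ t : ℝ, Φ t p ∈ Tprime d) ∧
    IsHamTrajOn h (fun t => Φ t p) Set.univ ∧
    (∀ γ : ℝ → Phase d, γ 0 = p → (∀ t : ℝ, γ t ∈ Tprime d) →
      IsHamTrajOn h γ Set.univ → γ = fun t => Φ t p)

/-- The function `(y, η) ↦ |x*(T; y, η) − y|² + |ξ*(T; y, η) − η|²`. -/
def periodDefect {d : ℕ} (Φ : ℝ → Phase d → Phase d) (T : ℝ) (p : Phase d) : ℝ :=
  (∑ j, ((Φ T p).1 j - p.1 j) ^ 2) + (∑ j, ((Φ T p).2 j - p.2 j) ^ 2)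

/-- `p₀ ∈ T'ℝ^d` is absolutely `T`-periodic: the period defect vanishes to infinite
order at `p₀`. -/
def AbsPeriodic {d : ℕ} (Φ : ℝ → Phase d → Phase d) (T : ℝ) (p₀ : Phase d) : Prop :=
  p₀ ∈ Tprime d ∧
  ∀ n : ℕ, iteratedFDerivWithin ℝ n (periodDefect Φ T) (Tprime d) p₀ = 0


namespace APD

variable {E F : Type*} [NormedAddCommGroup E] [NormedSpace ℝ E]
  [NormedAddCommGroup F] [NormedSpace ℝ F]

/-- Big-O flatness. -/
def FlatO (f : E → F) (p : E) : Prop :=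
  ∀ N : ℕ, f =O[𝓝 p] fun q => ‖q - p‖ ^ N

lemma taylor_bound {f : E → F} {s : Set E} (hs : Convex ℝ s)
    (hf : ∀ x ∈ s, ContDiffAt ℝ (⊤ : ℕ∞) f x) (N : ℕ) (C : ℝ)
    (hC : ∀ x ∈ s, ‖iteratedFDeriv ℝ N f x‖ ≤ C) {p : E} (hp : p ∈ s)
    (hz : ∀ n < N, iteratedFDeriv ℝ n f p = 0) :
    ∀ x ∈ s, ‖f x‖ ≤ C * ‖x - p‖ ^ N := by
  have key : ∀ j n : ℕ, n + j = N → ∀ x ∈ s, ‖iteratedFDeriv ℝ n f x‖ ≤ C * ‖x - p‖ ^ j := by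
    intro j
    induction j with
    | zero =>
      intro n hn x hx
      have : n = N := by omega
      subst this
      simpa using hC x hx
    | succ j ih =>
      intro n hn x hx
      have h1 := ih (n + 1) (by omega)
      have hC0 : 0 ≤ C := (norm_nonneg _).trans (hC p hp)
      have := Convex.norm_image_sub_le_of_norm_fderiv_le (𝕜 := ℝ) (f := iteratedFDeriv ℝ n f)
        (C := C * ‖x - p‖ ^ j) (s := s ∩ Metric.closedBall p ‖x - p‖) (x := p) (y := x)
        (fun y hy => by
          have := (hf y hy.1).iteratedFDeriv_right (m := 1) (i := n) (by exact_mod_cast le_top)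
          exact this.differentiableAt (by simp))
        (fun y hy => by
          rw [norm_fderiv_iteratedFDeriv]
          refine (h1 y hy.1).trans ?_
          have := hy.2
          rw [mem_closedBall_iff_norm] at this
          gcongr)
        (hs.inter (convex_closedBall _ _)) ⟨hp, by simp⟩ ⟨hx, by simp [dist_eq_norm]⟩
      rw [hz n (by omega), sub_zero] at this
      rw [pow_succ, ← mul_assoc]
      exact this
  intro x hx
  have := key N 0 (by omega) x hx
  simpa using this

lemma flatO_fderiv {f : E → F} {p : E} (hf : ContDiffAt ℝ (⊤ : ℕ∞) f p) (h : FlatO f p) :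
    FlatO (fderiv ℝ f) p := by
  have hz : fderiv ℝ f p = 0 := (Asymptotics.IsBigO.hasFDerivAt (h 2) (by norm_num)).fderiv
  have hlip : ContDiffAt ℝ 1 (fderiv ℝ f) p :=
    (hf.fderiv_right (m := (⊤ : ℕ∞)) (by exact_mod_cast le_top)).of_le (by exact_mod_cast le_top)
  obtain ⟨K, t, ht, hK⟩ := hlip.exists_lipschitzOnWith
  have hd : ∀ᶠ q in 𝓝 p, DifferentiableAt ℝ f q := by
    have h1 : ContDiffAt ℝ 1 f p := hf.of_le (by exact_mod_cast le_top)
    filter_upwards [h1.eventually (by simp)] with q hq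
    exact hq.differentiableAt (by simp)
  suffices H : ∀ N : ℕ, 1 ≤ N → fderiv ℝ f =O[𝓝 p] fun q => ‖q - p‖ ^ N by
    intro N
    rcases Nat.eq_zero_or_pos N with rfl | hN
    · refine (H 1 le_rfl).trans ?_
      refine Asymptotics.IsBigO.of_bound 1 ?_
      filter_upwards [Metric.ball_mem_nhds p one_pos] with q hq
      rw [mem_ball_iff_norm] at hq
      simpa using hq.le
    · exact H N hN
  intro N hN
  obtain ⟨C, hC0, hC⟩ := (h (2 * N)).exists_pos
  rw [Asymptotics.IsBigOWith] at hC
  obtain ⟨r, hr, hball⟩ := Metric.eventually_nhds_iff_ball.1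
    ((hd.and hC).and (show ∀ᶠ q in 𝓝 p, q ∈ t from ht))
  refine Asymptotics.IsBigO.of_bound (K + C * 2 ^ (2 * N) + C) ?_
  filter_upwards [Metric.ball_mem_nhds p (show 0 < min 1 (r / 2) by positivity)] with q hq
  rw [mem_ball_iff_norm, lt_min_iff] at hq
  obtain ⟨hq1, hqr⟩ := hq
  rcases eq_or_ne q p with rfl | hne
  · rw [hz]; simp only [norm_zero]; positivity
  have hρ : 0 < ‖q - p‖ := norm_pos_iff.2 (sub_ne_zero.2 hne)
  set ρ := ‖q - p‖ with hρd
  have hρN : ρ ^ N ≤ ρ := pow_le_of_le_one hρ.le hq1.le (by omega)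
  rw [Real.norm_of_nonneg (by positivity)]
  refine ContinuousLinearMap.opNorm_le_bound _ (by positivity) fun v => ?_
  rcases eq_or_ne v 0 with rfl | hv
  · simp
  have hv' : 0 < ‖v‖ := norm_pos_iff.2 hv
  set c := ρ ^ N / ‖v‖ with hc
  have hcpos : 0 < c := by positivity
  have hh : ‖c • v‖ = ρ ^ N := by
    rw [norm_smul, Real.norm_of_nonneg hcpos.le, hc]; field_simp
  have hqb : q ∈ Metric.ball p r := by rw [mem_ball_iff_norm]; linarith
  have hn2 : ‖q + c • v - p‖ ≤ 2 * ρ := by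
    calc ‖q + c • v - p‖ = ‖(q - p) + c • v‖ := by congr 1; abel
      _ ≤ ρ + ρ ^ N := (norm_add_le _ _).trans (by rw [hh])
      _ ≤ 2 * ρ := by linarith
  have hqhb : q + c • v ∈ Metric.ball p r := by rw [mem_ball_iff_norm]; linarith
  have hT := Convex.norm_image_sub_le_of_norm_fderiv_le' (𝕜 := ℝ) (f := f)
    (C := K * ρ ^ N) (s := Metric.ball p r ∩ Metric.closedBall q (ρ ^ N)) (x := q) (y := q + c • v)
    (φ := fderiv ℝ f q)
    (fun y hy => (hball y hy.1).1.1)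
    (fun y hy => by
      have := hK.dist_le_mul y (hball y hy.1).2 q (hball q hqb).2
      rw [dist_eq_norm] at this
      refine this.trans ?_
      have := hy.2
      rw [Metric.mem_closedBall] at this
      gcongr)
    ((convex_ball _ _).inter (convex_closedBall _ _)) ⟨hqb, by simp; positivity⟩
    ⟨hqhb, by simp only [mem_closedBall_iff_norm, add_sub_cancel_left, hh, le_refl]⟩
  rw [add_sub_cancel_left, hh, map_smul] at hT
  have f1 := (hball q hqb).1.2
  have f2 := (hball _ hqhb).1.2
  rw [Real.norm_of_nonneg (by positivity)] at f1 f2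
  have f3 : ‖f (q + c • v)‖ ≤ C * (2 * ρ) ^ (2 * N) := f2.trans (by gcongr)
  have f4 : ‖c • (fderiv ℝ f q) v‖ ≤
      K * ρ ^ N * ρ ^ N + C * (2 * ρ) ^ (2 * N) + C * ρ ^ (2 * N) := by
    calc ‖c • (fderiv ℝ f q) v‖ = ‖(f (q + c • v) - f q) -
          (f (q + c • v) - f q - c • (fderiv ℝ f q) v)‖ := by congr 1; abel
      _ ≤ ‖f (q + c • v)‖ + ‖f q‖ + ‖f (q + c • v) - f q - c • (fderiv ℝ f q) v‖ :=
          (norm_sub_le _ _).trans (by gcongr; exact norm_sub_le _ _)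
      _ ≤ _ := by linarith
  rw [norm_smul, Real.norm_of_nonneg hcpos.le, hc] at f4
  have f5 : K * ρ ^ N * ρ ^ N + C * (2 * ρ) ^ (2 * N) + C * ρ ^ (2 * N) =
      (ρ ^ N / ‖v‖) * ((K + C * 2 ^ (2 * N) + C) * ρ ^ N * ‖v‖) := by
    rw [mul_pow, two_mul N, pow_add ρ]; field_simp
  rw [f5] at f4
  exact le_of_mul_le_mul_left f4 (by positivity)

lemma flatO_iteratedFDeriv {f : E → F} {p : E} (hf : ContDiffAt ℝ (⊤ : ℕ∞) f p)
    (h : FlatO f p) (n : ℕ) : FlatO (iteratedFDeriv ℝ n f) p := by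
  induction n with
  | zero =>
    intro N
    refine Asymptotics.IsBigO.congr_left (h N).norm_left ?_ |>.of_norm_left
    intro x; simp
  | succ n ih =>
    have h1 := flatO_fderiv (hf.iteratedFDeriv_right (m := (⊤ : ℕ∞)) (i := n)
      (by exact_mod_cast le_top)) ih
    intro N
    refine Asymptotics.IsBigO.congr_left (h1 N).norm_left ?_ |>.of_norm_left
    intro x; rw [norm_fderiv_iteratedFDeriv]

lemma FlatO.eq_zero {f : E → F} {p : E} (h : FlatO f p) : f p = 0 := by
  have := (h 1).eq_zero_imp
  have := this.self_of_nhds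
  simpa using this

lemma FlatO.jet {f : E → F} {p : E} (hf : ContDiffAt ℝ (⊤ : ℕ∞) f p)
    (h : FlatO f p) (n : ℕ) : iteratedFDeriv ℝ n f p = 0 :=
  (flatO_iteratedFDeriv hf h n).eq_zero

lemma contDiffAt_param {f : ℝ → E → F} {z : ℝ × E}
    (hf : ContDiffAt ℝ (⊤ : ℕ∞) (fun z : ℝ × E => f z.1 z.2) z) (n : ℕ) :
    ContDiffAt ℝ (⊤ : ℕ∞) (fun z : ℝ × E => iteratedFDeriv ℝ n (f z.1) z.2) z := by
  induction n with
  | zero =>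
    simp only [iteratedFDeriv_zero_eq_comp, Function.comp]
    exact (continuousMultilinearCurryFin0 ℝ E F).symm.contDiff.contDiffAt.comp z hf
  | succ n ih =>
    simp only [iteratedFDeriv_succ_eq_comp_left, Function.comp]
    refine (LinearIsometryEquiv.contDiff (𝕜 := ℝ) (E := E →L[ℝ] (E [×n]→L[ℝ] F))
      (F := E [×(n + 1)]→L[ℝ] F) (continuousMultilinearCurryLeftEquiv ℝ
      (fun _ : Fin (n + 1) => E) F).symm).contDiffAt.comp z ?_
    refine ContDiffAt.fderiv (n := (⊤ : ℕ∞))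
      (f := fun (z : ℝ × E) (q : E) => iteratedFDeriv ℝ n (f z.1) q)
      (g := fun z : ℝ × E => z.2) ?_ contDiffAt_snd (by exact_mod_cast le_top)
    exact ContDiffAt.comp (g := fun z : ℝ × E => iteratedFDeriv ℝ n (f z.1) z.2)
      (f := fun w : (ℝ × E) × E => (w.1.1, w.2)) (z, z.2) ih
      ((contDiffAt_fst.fst).prodMk contDiffAt_snd)

lemma contDiffAt_slice {f : ℝ → E → F} {z : ℝ × E}
    (hf : ContDiffAt ℝ (⊤ : ℕ∞) (fun z : ℝ × E => f z.1 z.2) z) :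
    ContDiffAt ℝ (⊤ : ℕ∞) (f z.1) z.2 :=
  ContDiffAt.comp (g := fun z : ℝ × E => f z.1 z.2) (f := fun q => (z.1, q)) z.2 hf
    (contDiffAt_const.prodMk contDiffAt_id)

/-- uniform Taylor bound -/
lemma unif_taylor {f : ℝ → E → F} {V : Set (ℝ × E)} (hV : IsOpen V)
    (hf : ∀ z ∈ V, ContDiffAt ℝ (⊤ : ℕ∞) (fun z : ℝ × E => f z.1 z.2) z)
    {z₀ : ℝ × E} (hz₀ : z₀ ∈ V) (N : ℕ) :
    ∃ C : ℝ, 0 < C ∧ ∃ r : ℝ, 0 < r ∧ Metric.ball z₀ r ⊆ V ∧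
      ∀ t p q, (t, p) ∈ Metric.ball z₀ r → (t, q) ∈ Metric.ball z₀ r →
        (∀ n, iteratedFDeriv ℝ n (f t) p = 0) → ‖f t q‖ ≤ C * ‖q - p‖ ^ N := by
  have hc := (contDiffAt_param (hf z₀ hz₀) N).continuousAt.norm
  have hlt : ∀ᶠ z : ℝ × E in 𝓝 z₀, ‖iteratedFDeriv ℝ N (f z.1) z.2‖ <
      ‖iteratedFDeriv ℝ N (f z₀.1) z₀.2‖ + 1 := hc.eventually_lt_const (lt_add_one _)
  generalize ‖iteratedFDeriv ℝ N (f z₀.1) z₀.2‖ + 1 = C at hlt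
  obtain ⟨r, hr, hb⟩ := Metric.eventually_nhds_iff_ball.1 (hlt.and (hV.mem_nhds hz₀))
  refine ⟨C, (norm_nonneg _).trans_lt (hb z₀ (Metric.mem_ball_self hr)).1, r, hr, fun z hz => (hb z hz).2, ?_⟩
  intro t p q hp hq hz
  rw [← Prod.mk.eta (p := z₀), ← ball_prod_same] at hp hq
  have hmem : ∀ x, x ∈ Metric.ball z₀.2 r → (t, x) ∈ Metric.ball z₀ r := by
    intro x hx
    rw [← Prod.mk.eta (p := z₀), ← ball_prod_same]
    exact ⟨hp.1, hx⟩
  have h1 : ∀ x ∈ Metric.ball z₀.2 r, ContDiffAt ℝ (⊤ : ℕ∞) (f t) x := fun x hx =>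
    contDiffAt_slice (z := (t, x)) (hf (t, x) (hb (t, x) (hmem x hx)).2)
  have h2 : ∀ x ∈ Metric.ball z₀.2 r, ‖iteratedFDeriv ℝ N (f t) x‖ ≤ C := fun x hx =>
    (hb (t, x) (hmem x hx)).1.le
  exact taylor_bound (convex_ball z₀.2 r) h1 N C h2 hp.2 (fun n _ => hz n) q hq.2

lemma flat_of_jet {f : ℝ → E → F} {V : Set (ℝ × E)} (hV : IsOpen V)
    (hf : ∀ z ∈ V, ContDiffAt ℝ (⊤ : ℕ∞) (fun z : ℝ × E => f z.1 z.2) z)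
    {t : ℝ} {p : E} (hz₀ : (t, p) ∈ V)
    (hz : ∀ n, iteratedFDeriv ℝ n (f t) p = 0) : FlatO (f t) p := by
  intro N
  obtain ⟨C, _, r, hr, _, H⟩ := unif_taylor hV hf hz₀ N
  refine Asymptotics.IsBigO.of_bound C ?_
  filter_upwards [Metric.ball_mem_nhds p hr] with q hq
  rw [Real.norm_of_nonneg (by positivity)]
  refine H t p q (Metric.mem_ball_self hr) ?_ hz
  rw [← ball_prod_same]; exact ⟨Metric.mem_ball_self hr, hq⟩

/-- The topological lemma. -/
lemma const_of_lsc {f : ℝ → ℝ} (hl : LowerSemicontinuous f)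
    (h : ∀ a b c, a ≤ b → (∀ x ∈ Icc a b, f x ≤ c) → f a = f b) : ∀ a b, f a = f b := by
  -- locally bounded points
  set V : Set ℝ := {s | ∃ c : ℝ, ∀ᶠ x in 𝓝 s, f x ≤ c} with hVd
  have hVo : IsOpen V := by
    rw [isOpen_iff_mem_nhds]
    rintro s ⟨c, hc⟩
    filter_upwards [hc.eventually_nhds] with x hx using ⟨c, hx⟩
  have hVI : ∀ a b, a ≤ b → Icc a b ⊆ V → f a = f b := by
    intro a b hab hs
    have : ∃ c, ∀ x ∈ Icc a b, f x ≤ c := by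
      refine (isCompact_Icc (a := a) (b := b)).induction_on
        (p := fun S => ∃ c, ∀ x ∈ S, f x ≤ c) ⟨0, by simp⟩ ?_ ?_ ?_
      · rintro s t hst ⟨c, hc⟩; exact ⟨c, fun x hx => hc x (hst hx)⟩
      · rintro s t ⟨c, hc⟩ ⟨c', hc'⟩
        refine ⟨max c c', fun x hx => ?_⟩
        rcases hx with hx | hx
        · exact le_max_of_le_left (hc x hx)
        · exact le_max_of_le_right (hc' x hx)
      · intro x hx
        obtain ⟨c, hc⟩ := hs hx
        exact ⟨_, mem_nhdsWithin_of_mem_nhds hc, c, fun y hy => hy⟩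
    obtain ⟨c, hc⟩ := this
    exact h a b c hab hc
  suffices hall : V = univ by
    intro a b
    rcases le_total a b with hab | hab
    · exact hVI a b hab (by simp [hall])
    · exact (hVI b a hab (by simp [hall])).symm
  by_contra hne
  have hKne : (Vᶜ).Nonempty := by rwa [nonempty_compl]
  have hKc : IsClosed Vᶜ := hVo.isClosed_compl
  have : Nonempty (Vᶜ : Set ℝ) := hKne.to_subtype
  have : CompleteSpace (Vᶜ : Set ℝ) := hKc.completeSpace_coe
  obtain ⟨n, ⟨x0, hx0⟩⟩ := nonempty_interior_of_iUnion_of_closed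
    (f := fun n : ℕ => {x : (Vᶜ : Set ℝ) | f x ≤ n})
    (fun n => (hl.comp continuous_subtype_val).isClosed_preimage (n : ℝ))
    (by
      ext x; simp only [mem_iUnion, mem_ofPred_eq, mem_univ, iff_true]
      exact exists_nat_ge _)
  rw [mem_interior_iff_mem_nhds, nhds_subtype_eq_comap] at hx0
  obtain ⟨J, hJ, hJs⟩ := hx0
  obtain ⟨ε, hε, hb⟩ := Metric.mem_nhds_iff.1 hJ
  have hJn : ∀ x ∈ Metric.ball (x0 : ℝ) ε, x ∉ V → f x ≤ n := by
    intro x hx hxV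
    exact hJs (show (⟨x, hxV⟩ : (Vᶜ : Set ℝ)) ∈ Subtype.val ⁻¹' J from hb hx)
  have hball : ∀ x y z : ℝ, x ∈ Metric.ball (x0 : ℝ) ε → y ∈ Metric.ball (x0 : ℝ) ε →
      x ≤ z → z ≤ y → z ∈ Metric.ball (x0 : ℝ) ε := by
    intro x y z hx hy h1 h2
    rw [Real.ball_eq_Ioo] at *
    exact ⟨hx.1.trans_le h1, h2.trans_lt hy.2⟩
  apply x0.2
  refine ⟨n, ?_⟩
  filter_upwards [Metric.ball_mem_nhds (x0 : ℝ) hε] with s hs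
  by_cases hsV : s ∈ V
  swap
  · exact hJn s hs hsV
  have hx0b := Metric.mem_ball_self (x := (x0 : ℝ)) hε
  rcases le_total (x0 : ℝ) s with hle | hle
  · -- last point of K before s
    have hcpt : IsCompact (Vᶜ ∩ Icc (x0 : ℝ) s) := isCompact_Icc.inter_left hKc
    obtain ⟨a, ⟨haK, ha1, ha2⟩, hamax⟩ := hcpt.exists_isGreatest ⟨x0, x0.2, le_rfl, hle⟩
    have haf : f a ≤ n := hJn a (hball _ _ _ hx0b hs ha1 ha2) haK
    have hin : ∀ y, a < y → y ≤ s → y ∈ V := by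
      intro y hy1 hy2
      by_contra hyV
      exact absurd (hamax ⟨hyV, ha1.trans hy1.le, hy2⟩) (not_le.2 hy1)
    have hc : ∀ y, a < y → y ≤ s → f y = f s := fun y h1 h2 =>
      hVI y s h2 (fun w hw => hin w (h1.trans_le hw.1) hw.2)
    have := h a s (max n (f s)) ha2 (fun y hy => by
      rcases hy.1.eq_or_lt with rfl | hlt
      · exact le_max_of_le_left haf
      · exact le_max_of_le_right (hc y hlt hy.2).le)
    rw [← this]; exact haf
  · have hcpt : IsCompact (Vᶜ ∩ Icc s (x0 : ℝ)) := isCompact_Icc.inter_left hKc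
    obtain ⟨a, ⟨haK, ha1, ha2⟩, hamin⟩ := hcpt.exists_isLeast ⟨x0, x0.2, hle, le_rfl⟩
    have haf : f a ≤ n := hJn a (hball _ _ _ hs hx0b ha1 ha2) haK
    have hin : ∀ y, s ≤ y → y < a → y ∈ V := by
      intro y hy1 hy2
      by_contra hyV
      exact absurd (hamin ⟨hyV, hy1, hy2.le.trans ha2⟩) (not_le.2 hy2)
    have hc : ∀ y, s ≤ y → y < a → f s = f y := fun y h1 h2 =>
      hVI s y h1 (fun w hw => hin w hw.1 (hw.2.trans_lt h2))
    have := h s a (max n (f s)) ha1 (fun y hy => by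
      rcases hy.2.eq_or_lt with rfl | hlt
      · exact le_max_of_le_left haf
      · exact le_max_of_le_right (hc y hy.1 hlt).ge)
    rw [this]; exact haf


/-- Abstract properties of the flow which are used. -/
structure GoodFlow (U : Set E) (Φ : ℝ → E → E) : Prop where
  isOpen : IsOpen U
  smooth : ∀ z : ℝ × E, z.2 ∈ U → ContDiffAt ℝ (⊤ : ℕ∞) (fun z : ℝ × E => Φ z.1 z.2) z
  zero : ∀ p ∈ U, Φ 0 p = p
  mem : ∀ p ∈ U, ∀ t, Φ t p ∈ U
  add : ∀ p ∈ U, ∀ s t, Φ (s + t) p = Φ s (Φ t p)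
  vel : ∀ p ∈ U, ∀ t, ∃ v : E, v ≠ 0 ∧ HasDerivAt (fun t => Φ t p) v t

/-- Absolute periodicity in big-O form. -/
def AP (U : Set E) (Φ : ℝ → E → E) (t : ℝ) (p : E) : Prop :=
  p ∈ U ∧ FlatO (fun q => Φ t q - q) p

variable {U : Set E} {Φ : ℝ → E → E}

lemma AP.fix {t : ℝ} {p : E} (h : AP U Φ t p) : Φ t p = p :=
  sub_eq_zero.1 (h.2.eq_zero (f := fun q => Φ t q - q))

namespace GoodFlow

lemma smooth_u (H : GoodFlow U Φ) (z : ℝ × E) (hz : z.2 ∈ U) :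
    ContDiffAt ℝ (⊤ : ℕ∞) (fun z : ℝ × E => (fun t q => Φ t q - q) z.1 z.2) z :=
  (H.smooth z hz).sub contDiffAt_snd

lemma smooth_slice (H : GoodFlow U Φ) (t : ℝ) {p : E} (hp : p ∈ U) :
    ContDiffAt ℝ (⊤ : ℕ∞) (Φ t) p :=
  contDiffAt_slice (z := (t, p)) (H.smooth (t, p) hp)

lemma smooth_slice_u (H : GoodFlow U Φ) (t : ℝ) {p : E} (hp : p ∈ U) :
    ContDiffAt ℝ (⊤ : ℕ∞) (fun q => Φ t q - q) p :=
  (H.smooth_slice t hp).sub contDiffAt_id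

lemma cont_jet (H : GoodFlow U Φ) (t : ℝ) {p : E} (hp : p ∈ U) (n : ℕ) :
    ContinuousAt (fun z : ℝ × E => iteratedFDeriv ℝ n (fun q => Φ z.1 q - q) z.2) (t, p) :=
  (contDiffAt_param (f := fun t q => Φ t q - q) (H.smooth_u (t, p) hp) n).continuousAt

lemma ap_iff (H : GoodFlow U Φ) {t : ℝ} {p : E} (hp : p ∈ U) :
    AP U Φ t p ↔ ∀ n, iteratedFDeriv ℝ n (fun q => Φ t q - q) p = 0 := by
  constructor
  · intro h n
    exact FlatO.jet (H.smooth_slice_u t hp) h.2 n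
  · intro h
    exact ⟨hp, flat_of_jet (f := fun t q => Φ t q - q) (V := Prod.snd ⁻¹' U)
      (H.isOpen.preimage continuous_snd) (fun z hz => H.smooth_u z hz) hp h⟩

lemma lip (H : GoodFlow U Φ) (s : ℝ) {t : ℝ} {p : E} (h : AP U Φ t p) :
    ∃ K : ℝ, ∀ᶠ q in 𝓝 p, ‖Φ s (Φ t q) - Φ s q‖ ≤ K * ‖Φ t q - q‖ := by
  obtain ⟨K, S, hS, hK⟩ := ((H.smooth_slice s h.1).of_le (m := 1)
    (by exact_mod_cast le_top)).exists_lipschitzOnWith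
  refine ⟨K, ?_⟩
  have hc : Tendsto (Φ t) (𝓝 p) (𝓝 p) := by
    have := (H.smooth_slice t h.1).continuousAt
    rw [ContinuousAt, h.fix] at this
    exact this
  filter_upwards [hS, hc hS] with q hq hq'
  have := hK.dist_le_mul _ hq' _ hq
  rwa [dist_eq_norm, dist_eq_norm] at this

lemma ap_zero (H : GoodFlow U Φ) {p : E} (hp : p ∈ U) : AP U Φ 0 p := by
  refine ⟨hp, fun N => Asymptotics.IsBigO.of_bound 1 ?_⟩
  filter_upwards [H.isOpen.mem_nhds hp] with q hq
  rw [H.zero q hq]; simp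

lemma ap_add (H : GoodFlow U Φ) {s t : ℝ} {p : E} (hs : AP U Φ s p) (ht : AP U Φ t p) :
    AP U Φ (s + t) p := by
  refine ⟨hs.1, fun N => ?_⟩
  obtain ⟨K, hK⟩ := H.lip s ht
  have h1 : (fun q => Φ s (Φ t q) - Φ s q) =O[𝓝 p] fun q => ‖q - p‖ ^ N :=
    (Asymptotics.IsBigO.of_bound K hK).trans (ht.2 N)
  refine (h1.add (hs.2 N)).congr' ?_ EventuallyEq.rfl
  filter_upwards [H.isOpen.mem_nhds hs.1] with q hq
  rw [H.add q hq]; abel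

lemma ap_neg (H : GoodFlow U Φ) {t : ℝ} {p : E} (ht : AP U Φ t p) :
    AP U Φ (-t) p := by
  refine ⟨ht.1, fun N => ?_⟩
  obtain ⟨K, hK⟩ := H.lip (-t) ht
  have h1 : (fun q => Φ (-t) (Φ t q) - Φ (-t) q) =O[𝓝 p] fun q => ‖q - p‖ ^ N :=
    (Asymptotics.IsBigO.of_bound K hK).trans (ht.2 N)
  refine h1.neg_left.congr' ?_ EventuallyEq.rfl
  filter_upwards [H.isOpen.mem_nhds ht.1] with q hq
  rw [← H.add q hq, neg_add_cancel, H.zero q hq]; abel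

/-- The group of absolute periods. -/
def P (H : GoodFlow U Φ) (p : E) (hp : p ∈ U) : AddSubgroup ℝ where
  carrier := {t | AP U Φ t p}
  zero_mem' := H.ap_zero hp
  add_mem' := fun hs ht => H.ap_add hs ht
  neg_mem' := fun ht => H.ap_neg ht

lemma not_ap_eventually (H : GoodFlow U Φ) {t : ℝ} {p : E} (hp : p ∈ U) (h : ¬ AP U Φ t p) :
    ∀ᶠ z : ℝ × E in 𝓝 (t, p), ¬ AP U Φ z.1 z.2 := by
  rw [H.ap_iff hp, not_forall] at h
  obtain ⟨n, hn⟩ := h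
  have hc := H.cont_jet t hp n
  filter_upwards [hc.eventually_ne hn] with z hz hap
  exact hz ((H.ap_iff hap.1).1 hap n)

lemma expand (H : GoodFlow U Φ) (t₀ : ℝ) {p : E} (hp : p ∈ U) :
    ∃ c : ℝ, 0 < c ∧ ∃ r : ℝ, 0 < r ∧ ∀ t t' q, (t, q) ∈ Metric.ball (t₀, p) r →
      (t', q) ∈ Metric.ball (t₀, p) r → c * |t - t'| ≤ ‖Φ t q - Φ t' q‖ := by
  have hst := (H.smooth (t₀, p) hp).hasStrictFDerivAt (by simp)
  set L := fderiv ℝ (fun z : ℝ × E => Φ z.1 z.2) (t₀, p) with hL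
  obtain ⟨v, hv, hvd⟩ := H.vel p hp t₀
  have hLv : L (1, 0) = v := by
    have h1 : HasDerivAt (fun t => Φ t p) (L (1, 0)) t₀ := by
      have h2 : HasDerivAt (fun t : ℝ => (t, p)) ((1 : ℝ), (0 : E)) t₀ :=
        (hasDerivAt_id t₀).prodMk (hasDerivAt_const t₀ p)
      exact HasFDerivAt.comp_hasDerivAt (f := fun t : ℝ => (t, p)) t₀ hst.hasFDerivAt h2
    exact h1.unique hvd
  have hvpos : 0 < ‖v‖ := norm_pos_iff.2 hv
  have hlo := hst.isLittleO.def (show 0 < ‖v‖ / 2 by positivity)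
  rw [nhds_prod_eq] at hlo
  obtain ⟨S, hS, hSS⟩ := Filter.mem_prod_same_iff.1 hlo
  obtain ⟨r, hr, hrS⟩ := Metric.mem_nhds_iff.1 hS
  refine ⟨‖v‖ / 2, by positivity, r, hr, ?_⟩
  intro t t' q h1 h2
  have h3 := hSS (Set.mk_mem_prod (hrS h1) (hrS h2))
  have h3 : ‖Φ t q - Φ t' q - L ((t, q) - (t', q))‖ ≤ ‖v‖ / 2 * ‖((t, q) : ℝ × E) - (t', q)‖ := h3
  have h4 : ((t, q) : ℝ × E) - (t', q) = (t - t') • ((1 : ℝ), (0 : E)) := by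
    simp
  have h5 : ‖((t, q) : ℝ × E) - (t', q)‖ = |t - t'| := by
    simp [Prod.norm_def]
  rw [h5, h4, map_smul, hLv] at h3
  have h6 : ‖(t - t') • v‖ = |t - t'| * ‖v‖ := by rw [norm_smul, Real.norm_eq_abs]
  have h7 : ‖(t - t') • v‖ ≤ ‖Φ t q - Φ t' q‖ + ‖Φ t q - Φ t' q - (t - t') • v‖ := by
    have := norm_sub_le (Φ t q - Φ t' q) (Φ t q - Φ t' q - (t - t') • v)
    simpa using this
  nlinarith

lemma small_period (H : GoodFlow U Φ) {p : E} (hp : p ∈ U) :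
    ∀ᶠ z : ℝ × E in 𝓝 ((0 : ℝ), p), AP U Φ z.1 z.2 → z.1 = 0 := by
  obtain ⟨c, hc, r, hr, h⟩ := H.expand 0 hp
  filter_upwards [Metric.ball_mem_nhds _ hr] with z hz hap
  have h1 : ((0 : ℝ), z.2) ∈ Metric.ball ((0 : ℝ), p) r := by
    rw [← ball_prod_same] at hz ⊢
    exact ⟨Metric.mem_ball_self hr, hz.2⟩
  have := h z.1 0 z.2 hz h1
  rw [hap.fix, H.zero _ hap.1, sub_self, norm_zero, sub_zero] at this
  have h2 : |z.1| ≤ 0 := by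
    by_contra hcon
    push Not at hcon
    have := mul_pos hc hcon
    linarith
  exact abs_eq_zero.1 (le_antisymm h2 (abs_nonneg _))

lemma iter_nat (H : GoodFlow U Φ) {t : ℝ} {p : E} (h : AP U Φ t p) (i : ℕ) :
    AP U Φ (i * t) p := by
  have := (H.P p h.1).nsmul_mem h i
  rw [nsmul_eq_mul] at this
  exact this

lemma lip_small (H : GoodFlow U Φ) {t₀ : ℝ} {p : E} (h : AP U Φ t₀ p) {ε : ℝ} (hεpos : 0 < ε) :
    ∃ r : ℝ, 0 < r ∧ Metric.ball p r ⊆ U ∧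
    ∀ t x y, |t - t₀| < r → x ∈ Metric.ball p r → y ∈ Metric.ball p r →
      ‖(Φ t y - y) - (Φ t x - x)‖ ≤ ε * ‖y - x‖ := by
  have hp := h.1
  have hd := (H.cont_jet t₀ hp 1).norm
  have hd0 : ‖iteratedFDeriv ℝ 1 (fun q => Φ t₀ q - q) p‖ < ε := by
    rw [(H.ap_iff hp).1 h 1, norm_zero]; exact hεpos
  have hdε : ∀ᶠ z : ℝ × E in 𝓝 (t₀, p),
      ‖iteratedFDeriv ℝ 1 (fun q => Φ z.1 q - q) z.2‖ < ε := hd.eventually_lt_const hd0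
  have hUe : ∀ᶠ z : ℝ × E in 𝓝 (t₀, p), z.2 ∈ U :=
    continuous_snd.continuousAt.eventually (H.isOpen.mem_nhds hp)
  obtain ⟨r, hr, hball⟩ := Metric.eventually_nhds_iff_ball.1 (hdε.and hUe)
  have hm : ∀ t, |t - t₀| < r → ∀ w ∈ Metric.ball p r, (t, w) ∈ Metric.ball (t₀, p) r := by
    intro t ht w hw
    rw [← ball_prod_same]
    exact ⟨by rwa [Metric.mem_ball, Real.dist_eq], hw⟩
  refine ⟨r, hr, fun w hw => (hball _ (hm t₀ (by simpa using hr) w hw)).2, ?_⟩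
  intro t x y ht hx hy
  have h1 : ∀ w ∈ Metric.ball p r, DifferentiableAt ℝ (fun q => Φ t q - q) w := fun w hw =>
    (H.smooth_slice_u t (hball _ (hm t ht w hw)).2).differentiableAt (by simp)
  have h2 : ∀ w ∈ Metric.ball p r, ‖fderiv ℝ (fun q => Φ t q - q) w‖ ≤ ε := fun w hw => by
    have := (hball _ (hm t ht w hw)).1.le
    rwa [norm_iteratedFDeriv_one] at this
  exact Convex.norm_image_sub_le_of_norm_fderiv_le (𝕜 := ℝ) (f := fun q => Φ t q - q)
      (s := Metric.ball p r) h1 h2 (convex_ball _ _) hx hy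

/-- Key lemma: roots of the period. -/
lemma root (H : GoodFlow U Φ) {t₀ : ℝ} {p : E} (h : AP U Φ t₀ p) (k : ℕ) (hk : 1 ≤ k) :
    ∀ᶠ z : ℝ × E in 𝓝 (t₀, p), AP U Φ (k * z.1) z.2 → AP U Φ z.1 z.2 := by
  have hp := h.1
  have hk' : (1 : ℝ) ≤ k := by exact_mod_cast hk
  set ε : ℝ := 1 / (2 * k * (k + 1)) with hε
  have hεpos : 0 < ε := by positivity
  obtain ⟨r, hr, hbU, hlip⟩ := H.lip_small h hεpos
  -- iterates stay in the ball
  have hstay : ∀ i : ℕ, ∀ᶠ z : ℝ × E in 𝓝 (t₀, p), Φ (i * z.1) z.2 ∈ Metric.ball p r := by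
    intro i
    have hc : ContinuousAt (fun z : ℝ × E => Φ (i * z.1) z.2) (t₀, p) :=
      ContinuousAt.comp (g := fun z : ℝ × E => Φ z.1 z.2)
        (f := fun z : ℝ × E => ((i : ℝ) * z.1, z.2)) (H.smooth (i * t₀, p) hp).continuousAt
        (by fun_prop)
    refine hc.eventually (?_ : ∀ᶠ y in 𝓝 (Φ (i * t₀) p), y ∈ Metric.ball p r)
    rw [(H.iter_nat h i).fix]
    exact Metric.ball_mem_nhds p hr
  have hstay' : ∀ᶠ z : ℝ × E in 𝓝 (t₀, p), ∀ i ∈ Finset.range (k + 1),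
      Φ (i * z.1) z.2 ∈ Metric.ball p r :=
    (Filter.eventually_all_finset _).2 fun i _ => hstay i
  have hmain : ∀ᶠ z : ℝ × E in 𝓝 (t₀, p),
      ‖Φ z.1 z.2 - z.2‖ ≤ 2 * ‖Φ (k * z.1) z.2 - z.2‖ := by
    filter_upwards [hstay', Metric.ball_mem_nhds _ hr] with z hz hzb
    obtain ⟨t, q⟩ := z
    rw [← ball_prod_same] at hzb
    obtain ⟨htb, hqb⟩ := hzb
    have hqU := hbU hqb
    simp only at hz htb hqb hqU ⊢
    rw [Metric.mem_ball, Real.dist_eq] at htb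
    set w := Φ t q - q with hw
    have e : ∀ i : ℕ, i ≤ k → ‖Φ (i * t) q - q - (i : ℝ) • w‖ ≤ i / (2 * k) * ‖w‖ := by
      intro i
      induction i with
      | zero => intro _; simp [H.zero q hqU]
      | succ i ih =>
        intro hi
        have ihi := ih (by omega)
        have hi' : (i : ℝ) + 1 ≤ k := by exact_mod_cast hi
        have hstep : Φ ((i + 1 : ℕ) * t) q = Φ t (Φ (i * t) q) := by
          rw [← H.add q hqU]; congr 1; push_cast; ring
        have hl := hlip t q (Φ (i * t) q) htb hqb (hz i (by simp; omega))
        have hn : ‖Φ (i * t) q - q‖ ≤ (k + 1) * ‖w‖ := by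
          have h1 : ‖Φ (i * t) q - q‖ ≤ ‖Φ (i * t) q - q - (i : ℝ) • w‖ + ‖(i : ℝ) • w‖ := by
            have := norm_add_le (Φ (i * t) q - q - (i : ℝ) • w) ((i : ℝ) • w)
            simpa using this
          rw [norm_smul, Real.norm_natCast] at h1
          have h2 : (i : ℝ) / (2 * k) ≤ 1 := by
            rw [div_le_one (by positivity)]; linarith
          have h3 : (i : ℝ) / (2 * k) * ‖w‖ ≤ 1 * ‖w‖ := by gcongr
          have h4 : (i : ℝ) * ‖w‖ ≤ k * ‖w‖ := by gcongr; linarith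
          linarith
        have hA : Φ ((i + 1 : ℕ) * t) q - q - ((i + 1 : ℕ) : ℝ) • w =
            (Φ (i * t) q - q - (i : ℝ) • w) +
            ((Φ t (Φ (i * t) q) - Φ (i * t) q) - (Φ t q - q)) := by
          rw [hstep, ← hw]; push_cast; rw [add_smul, one_smul]; abel
        rw [hA]
        refine (norm_add_le _ _).trans ?_
        have hB : ε * ‖Φ (i * t) q - q‖ ≤ 1 / (2 * k) * ‖w‖ := by
          calc ε * ‖Φ (i * t) q - q‖ ≤ ε * ((k + 1) * ‖w‖) := by gcongr
            _ = 1 / (2 * k) * ‖w‖ := by rw [hε]; field_simp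
        have hCC : ((i + 1 : ℕ) : ℝ) / (2 * k) * ‖w‖ =
            i / (2 * k) * ‖w‖ + 1 / (2 * k) * ‖w‖ := by push_cast; ring
        rw [hCC]
        linarith
    have ek := e k le_rfl
    have h1 : ‖(k : ℝ) • w‖ ≤ ‖Φ (k * t) q - q‖ + ‖Φ (k * t) q - q - (k : ℝ) • w‖ := by
      have := norm_sub_le (Φ (k * t) q - q) (Φ (k * t) q - q - (k : ℝ) • w)
      simpa using this
    rw [norm_smul, Real.norm_natCast] at h1
    have h2 : (k : ℝ) / (2 * k) = 1 / 2 := by field_simp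
    rw [h2] at ek
    have h3 : 1 * ‖w‖ ≤ k * ‖w‖ := by gcongr
    linarith
  filter_upwards [hmain.eventually_nhds] with z hz hap
  refine ⟨hap.1, fun N => ?_⟩
  refine (Asymptotics.IsBigO.of_bound 2 ?_).trans (hap.2 N)
  have hc : Tendsto (fun q : E => (z.1, q)) (𝓝 z.2) (𝓝 z) := by
    have : ContinuousAt (fun q : E => (z.1, q)) z.2 := by fun_prop
    exact this
  exact hc.eventually hz

lemma holder_loc (H : GoodFlow U Φ) {z₀ : ℝ × E} (hz : z₀.2 ∈ U) (N : ℕ) :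
    ∃ C : ℝ, 0 < C ∧ ∃ r : ℝ, 0 < r ∧ ∀ z ∈ Metric.ball z₀ r, ∀ z' ∈ Metric.ball z₀ r,
      AP U Φ z.1 z.2 → AP U Φ z'.1 z'.2 → dist z.1 z'.1 ≤ C * dist z z' ^ N := by
  obtain ⟨C, hC, r, hr, _, hT⟩ := unif_taylor (f := fun t q => Φ t q - q) (V := Prod.snd ⁻¹' U)
      (H.isOpen.preimage continuous_snd) (fun z hz => H.smooth_u z hz) hz N
  obtain ⟨c, hc, r', hr', hE⟩ := H.expand z₀.1 hz
  refine ⟨C / c, by positivity, min r r', by positivity, ?_⟩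
  intro z h1 z' h2 hz1 hz2
  have b1 : z ∈ Metric.ball z₀ r := Metric.ball_subset_ball (min_le_left _ _) h1
  have b1' : z ∈ Metric.ball z₀ r' := Metric.ball_subset_ball (min_le_right _ _) h1
  have b2 : z' ∈ Metric.ball z₀ r := Metric.ball_subset_ball (min_le_left _ _) h2
  have b2' : z' ∈ Metric.ball z₀ r' := Metric.ball_subset_ball (min_le_right _ _) h2
  have b3 : (z.1, z'.2) ∈ Metric.ball z₀ r := by
    rw [← Prod.mk.eta (p := z₀), ← ball_prod_same] at *
    exact ⟨b1.1, b2.2⟩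
  have b3' : (z.1, z'.2) ∈ Metric.ball z₀ r' := by
    rw [← Prod.mk.eta (p := z₀), ← ball_prod_same] at *
    exact ⟨b1'.1, b2'.2⟩
  have e1 := hT z.1 z.2 z'.2 b1 b3 ((H.ap_iff hz1.1).1 hz1)
  have e2 := hE z.1 z'.1 z'.2 b3' b2'
  rw [hz2.fix] at e2
  have e3 : ‖z'.2 - z.2‖ ≤ dist z z' := by
    rw [← dist_eq_norm, dist_comm, Prod.dist_eq]; exact le_max_right _ _
  have e4 : C * ‖z'.2 - z.2‖ ^ N ≤ C * dist z z' ^ N := by gcongr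
  rw [Real.dist_eq, div_mul_eq_mul_div, le_div_iff₀ hc, mul_comm]
  exact e2.trans (e1.trans e4)

lemma periods_dimH [FiniteDimensional ℝ E] (H : GoodFlow U Φ) :
    dimH (Prod.fst '' {z : ℝ × E | AP U Φ z.1 z.2}) < 1 := by
  set n := Module.finrank ℝ (ℝ × E) with hn
  have hle := dimH_image_le_of_locally_holder_on (r := ((n + 1 : ℕ) : NNReal))
    (f := (Prod.fst : ℝ × E → ℝ)) (by positivity) (s := {z : ℝ × E | AP U Φ z.1 z.2})
    (fun z₀ hz₀ => by
      obtain ⟨C, hC, r, hr, h⟩ := H.holder_loc (z₀ := z₀) hz₀.1 (n + 1)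
      refine ⟨C.toNNReal, _, inter_mem_nhdsWithin _ (Metric.ball_mem_nhds z₀ hr), ?_⟩
      intro z hz z' hz'
      have := h z hz.2 z' hz'.2 hz.1 hz'.1
      rw [edist_dist, edist_dist, NNReal.coe_natCast, ENNReal.rpow_natCast,
        ← ENNReal.ofReal_pow dist_nonneg]
      change ENNReal.ofReal _ ≤ ENNReal.ofReal C * _
      rw [← ENNReal.ofReal_mul hC.le]
      exact ENNReal.ofReal_le_ofReal this)
  refine hle.trans_lt ?_
  have h1 : dimH {z : ℝ × E | AP U Φ z.1 z.2} ≤ n := by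
    rw [hn, ← Real.dimH_univ_eq_finrank]
    exact dimH_mono (subset_univ _)
  rw [ENNReal.div_lt_iff (by left; simp) (by left; simp), one_mul]
  refine h1.trans_lt ?_
  have : ((n : ℕ) : ENNReal) < ((n + 1 : ℕ) : ENNReal) := by
    exact_mod_cast Nat.lt_succ_self n
  simpa using this

lemma eq_of_mem_ordConnected {S : Set ℝ} (hS : dimH S < 1) {A : Set ℝ} (hA : IsPreconnected A)
    (hAS : A ⊆ S) {x y : ℝ} (hx : x ∈ A) (hy : y ∈ A) : x = y := by
  wlog hxy : x ≤ y generalizing x y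
  · exact (this hy hx (le_of_not_ge hxy)).symm
  by_contra hne
  have hlt : x < y := lt_of_le_of_ne hxy hne
  have hsub : Icc x y ⊆ S := (hA.ordConnected.out hx hy).trans hAS
  have h1 : dimH (Icc x y) = (Module.finrank ℝ ℝ : ENNReal) :=
    Real.dimH_of_nonempty_interior (by rw [interior_Icc]; exact nonempty_Ioo.2 hlt)
  have h2 := dimH_mono hsub
  rw [h1] at h2
  simp at h2
  exact absurd hS (not_lt.2 h2)

lemma exists_min (H : GoodFlow U Φ) {p : E} (h : ∃ T, 0 < T ∧ AP U Φ T p) :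
    ∃ τ, 0 < τ ∧ AP U Φ τ p ∧ (∀ t, 0 < t → AP U Φ t p → τ ≤ t) ∧
      (∀ t, AP U Φ t p ↔ ∃ k : ℤ, t = k * τ) := by
  obtain ⟨T, hT, hTp⟩ := h
  have hp := hTp.1
  have h0 : ∀ᶠ t : ℝ in 𝓝 0, AP U Φ t p → t = 0 := by
    have hc : Tendsto (fun t : ℝ => (t, p)) (𝓝 0) (𝓝 ((0 : ℝ), p)) := by
      have : ContinuousAt (fun t : ℝ => (t, p)) 0 := by fun_prop
      exact this
    exact hc.eventually (H.small_period hp)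
  obtain ⟨ε, hε, hb⟩ := Metric.eventually_nhds_iff_ball.1 h0
  have hne : H.P p hp ≠ ⊥ := by
    intro hbot
    have : T ∈ H.P p hp := hTp
    rw [hbot, AddSubgroup.mem_bot] at this
    exact hT.ne' this
  obtain ⟨τ, hτ⟩ := AddSubgroup.exists_isLeast_pos hne hε (by
    rw [Set.disjoint_left]
    intro t ht hI
    have := hb t (by rw [Metric.mem_ball, Real.dist_eq, sub_zero, abs_of_pos hI.1]; exact hI.2) ht
    exact hI.1.ne' this)
  refine ⟨τ, hτ.1.2, hτ.1.1, fun t ht hap => hτ.2 ⟨hap, ht⟩, fun t => ?_⟩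
  have hcyc := AddSubgroup.cyclic_of_min hτ
  have : AP U Φ t p ↔ t ∈ H.P p hp := Iff.rfl
  rw [this, hcyc, AddSubgroup.mem_closure_singleton]
  constructor
  · rintro ⟨k, rfl⟩; exact ⟨k, by simp⟩
  · rintro ⟨k, rfl⟩; exact ⟨k, by simp⟩

theorem main [FiniteDimensional ℝ E] (H : GoodFlow U Φ) {γ : ℝ → E} (hγ : Continuous γ)
    (hper : ∀ s, ∃ T, 0 < T ∧ AP U Φ T (γ s)) {T : ℝ} {a b : ℝ} (ha : AP U Φ T (γ a)) :
    AP U Φ T (γ b) := by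
  choose τ hτpos hτ hmin hτiff using fun s => H.exists_min (hper s)
  have hloc : ∀ s₀ c ε, 0 < ε → ∀ᶠ s in 𝓝 s₀, τ s ≤ c → |τ s - τ s₀| < ε := by
    intro s₀ c ε hε
    have hp : γ s₀ ∈ U := (hτ s₀).1
    have key : ∀ᶠ s in 𝓝 s₀, ∀ t ∈ Icc 0 c, τ s = t → |τ s - τ s₀| < ε := by
      refine IsCompact.eventually_forall_of_forall_eventually isCompact_Icc
        (P := fun s t => τ s = t → |τ s - τ s₀| < ε) ?_
      intro t ht
      have hc : Tendsto (fun z : ℝ × ℝ => (z.2, γ z.1)) (𝓝 (s₀, t)) (𝓝 (t, γ s₀)) := by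
        have : ContinuousAt (fun z : ℝ × ℝ => (z.2, γ z.1)) (s₀, t) := by fun_prop
        exact this
      rcases ht.1.eq_or_lt with h0 | htpos
      · subst h0
        filter_upwards [hc.eventually (H.small_period hp)] with z hz hzz
        have h1 : AP U Φ z.2 (γ z.1) := by rw [← hzz]; exact hτ z.1
        have := hz h1
        exact absurd (hzz.trans this) (hτpos _).ne'
      by_cases hap : AP U Φ t (γ s₀)
      swap
      · filter_upwards [hc.eventually (H.not_ap_eventually hp hap)] with z hz hzz
        exact absurd (by rw [← hzz]; exact hτ z.1) hz
      obtain ⟨k, hk⟩ := (hτiff s₀ t).1 hap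
      have hkpos : 0 < k := by
        rw [hk] at htpos
        exact_mod_cast (pos_iff_pos_of_mul_pos htpos).2 (hτpos s₀)
      lift k to ℕ using hkpos.le
      have hkpos' : 0 < k := by exact_mod_cast hkpos
      simp only [Int.cast_natCast] at hk
      rcases Nat.eq_or_lt_of_le (show 1 ≤ k from hkpos') with hk1 | hk1
      · have : t = τ s₀ := by rw [hk, ← hk1]; simp
        have hcc : ∀ᶠ z : ℝ × ℝ in 𝓝 (s₀, t), z.2 ∈ Metric.ball t ε :=
          continuous_snd.continuousAt.eventually (Metric.ball_mem_nhds t hε)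
        filter_upwards [hcc] with z hz hzz
        rw [hzz, ← this]
        rwa [Metric.mem_ball, Real.dist_eq] at hz
      · have hkR : (1 : ℝ) < k := by exact_mod_cast hk1
        have hc2 : Tendsto (fun z : ℝ × ℝ => (z.2 / k, γ z.1)) (𝓝 (s₀, t))
            (𝓝 (τ s₀, γ s₀)) := by
          have h1 : ContinuousAt (fun z : ℝ × ℝ => (z.2 / k, γ z.1)) (s₀, t) := by fun_prop
          have h2 : t / k = τ s₀ := by rw [hk]; field_simp
          rw [ContinuousAt] at h1
          simp only [h2] at h1
          exact h1
        filter_upwards [hc2.eventually (H.root (hτ s₀) k hkpos')] with z hz hzz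
        have h1 : (k : ℝ) * (z.2 / k) = z.2 := by field_simp
        simp only [h1] at hz
        have h2 := hz (by rw [← hzz]; exact hτ z.1)
        rw [← hzz] at h2
        have hp1 := hτpos z.1
        have h3 := hmin z.1 _ (by positivity) h2
        have h4 : τ z.1 / k < τ z.1 := div_lt_self hp1 hkR
        exact absurd h3 (not_le.2 h4)
    filter_upwards [key] with s hs hsc
    exact hs (τ s) ⟨(hτpos s).le, hsc⟩ rfl
  have hconst : ∀ a b, τ a = τ b := by
    refine const_of_lsc ?_ ?_
    · intro s₀ y hy
      filter_upwards [hloc s₀ y (τ s₀ - y) (by linarith)] with s hs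
      by_contra hle
      push Not at hle
      have := hs hle
      rw [abs_lt] at this
      linarith
    · intro a b c hab hbd
      have hcont : ContinuousOn τ (Icc a b) := by
        intro s hs
        rw [ContinuousWithinAt, Metric.tendsto_nhds]
        intro ε hε
        filter_upwards [mem_nhdsWithin_of_mem_nhds (hloc s c ε hε), self_mem_nhdsWithin]
          with x hx hxI
        rw [Real.dist_eq]
        exact hx (hbd x hxI)
      have hpre := isPreconnected_Icc.image τ hcont
      refine eq_of_mem_ordConnected H.periods_dimH hpre ?_ ⟨a, ⟨le_rfl, hab⟩, rfl⟩
        ⟨b, ⟨hab, le_rfl⟩, rfl⟩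
      rintro _ ⟨s, _, rfl⟩
      exact ⟨(τ s, γ s), hτ s, rfl⟩
  rw [hτiff] at ha ⊢
  rwa [hconst b a]

end GoodFlow

end APD

open APD

lemma sum_sq_bound {d : ℕ} (v : Phase d) :
    ‖v‖ ^ 2 ≤ (∑ j, (v.1 j) ^ 2) + (∑ j, (v.2 j) ^ 2) ∧
    (∑ j, (v.1 j) ^ 2) + (∑ j, (v.2 j) ^ 2) ≤ (2 * d) * ‖v‖ ^ 2 := by
  have n1 : 0 ≤ ∑ j, (v.1 j) ^ 2 := Finset.sum_nonneg fun _ _ => sq_nonneg _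
  have n2 : 0 ≤ ∑ j, (v.2 j) ^ 2 := Finset.sum_nonneg fun _ _ => sq_nonneg _
  have hw : ∀ w : Fin d → ℝ, ‖w‖ ≤ Real.sqrt (∑ j, (w j) ^ 2) := by
    intro w
    rw [pi_norm_le_iff_of_nonneg (Real.sqrt_nonneg _)]
    intro j
    refine Real.le_sqrt_of_sq_le ?_
    rw [Real.norm_eq_abs, sq_abs]
    exact Finset.single_le_sum (f := fun j => (w j) ^ 2) (fun _ _ => sq_nonneg _)
      (Finset.mem_univ j)
  have hw2 : ∀ w : Fin d → ℝ, ‖w‖ ^ 2 ≤ ∑ j, (w j) ^ 2 := by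
    intro w
    have h0 : 0 ≤ ∑ j, (w j) ^ 2 := Finset.sum_nonneg fun _ _ => sq_nonneg _
    calc ‖w‖ ^ 2 ≤ (Real.sqrt (∑ j, (w j) ^ 2)) ^ 2 := by gcongr; exact hw w
      _ = _ := Real.sq_sqrt h0
  have hw3 : ∀ w : Fin d → ℝ, ∑ j, (w j) ^ 2 ≤ d * ‖w‖ ^ 2 := by
    intro w
    calc ∑ j, (w j) ^ 2 ≤ ∑ _j : Fin d, ‖w‖ ^ 2 := by
          refine Finset.sum_le_sum fun j _ => ?_
          rw [← sq_abs, ← Real.norm_eq_abs]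
          gcongr
          exact norm_le_pi_norm w j
      _ = d * ‖w‖ ^ 2 := by simp
  constructor
  · have h1 := hw2 v.1
    have h2 := hw2 v.2
    rw [Prod.norm_def]
    rcases le_total ‖v.1‖ ‖v.2‖ with h | h
    · rw [max_eq_right h]; linarith
    · rw [max_eq_left h]; linarith
  · have h1 := hw3 v.1
    have h2 := hw3 v.2
    have h3 : ‖v.1‖ ≤ ‖v‖ := norm_fst_le v
    have h4 : ‖v.2‖ ≤ ‖v‖ := norm_snd_le v
    have h5 : d * ‖v.1‖ ^ 2 ≤ d * ‖v‖ ^ 2 := by gcongr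
    have h6 : d * ‖v.2‖ ^ 2 ≤ d * ‖v‖ ^ 2 := by gcongr
    linarith

lemma isOpen_Tprime (d : ℕ) : IsOpen (Tprime d) :=
  isOpen_ne.preimage continuous_snd

lemma hamField_ne_zero {d : ℕ} {h : Phase d → ℝ} (hh : HomHamiltonian h) {p : Phase d}
    (hp : p ∈ Tprime d) : hamField h p ≠ 0 := by
  intro h0
  have hd : DifferentiableAt ℝ h p :=
    (hh.1.contDiffAt ((isOpen_Tprime d).mem_nhds hp)).differentiableAt (by simp)
  have hj : ∀ j, fderiv ℝ h p (0, Pi.single j 1) = 0 := fun j =>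
    congrFun (congrArg Prod.fst h0) j
  have hz : fderiv ℝ h p (0, p.2) = 0 := by
    have : ((0, p.2) : Phase d) = ∑ j, p.2 j • ((0, Pi.single j 1) : Phase d) := by
      ext i
      · simp [Prod.fst_sum, Finset.sum_apply]
      · simp [Prod.snd_sum, Finset.sum_apply, Pi.single_apply]
    rw [this, map_sum]
    refine Finset.sum_eq_zero fun j _ => ?_
    rw [map_smul, hj, smul_zero]
  have hc : HasDerivAt (fun c : ℝ => ((p.1, c • p.2) : Phase d)) (0, p.2) 1 := by
    have := (hasDerivAt_const (1 : ℝ) p.1).prodMk ((hasDerivAt_id (1 : ℝ)).smul_const p.2)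
    simpa using this
  have h1 : HasDerivAt (fun c : ℝ => h (p.1, c • p.2)) (fderiv ℝ h p (0, p.2)) 1 := by
    refine HasFDerivAt.comp_hasDerivAt (f := fun c : ℝ => ((p.1, c • p.2) : Phase d)) 1 ?_ hc
    simpa using hd.hasFDerivAt
  have h2 : HasDerivAt (fun c : ℝ => h (p.1, c • p.2)) (h p) 1 := by
    have h3 : HasDerivAt (fun c : ℝ => c * h p) (h p) 1 := by
      simpa using (hasDerivAt_id (1 : ℝ)).mul_const (h p)
    refine h3.congr_of_eventuallyEq ?_
    filter_upwards [lt_mem_nhds (zero_lt_one (α := ℝ))] with c hc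
    exact hh.2.2 p hp c hc
  have := h1.unique h2
  rw [hz] at this
  exact (hh.2.1 p hp).ne this

lemma goodFlow {d : ℕ} {h : Phase d → ℝ} (hh : HomHamiltonian h)
    {Φ : ℝ → Phase d → Phase d} (hΦ : IsCompleteFlow h Φ) : GoodFlow (Tprime d) Φ where
  isOpen := isOpen_Tprime d
  smooth := fun z hz => hΦ.1.contDiffAt
    ((isOpen_univ.prod (isOpen_Tprime d)).mem_nhds ⟨mem_univ _, hz⟩)
  zero := fun p hp => (hΦ.2 p hp).1
  mem := fun p hp => (hΦ.2 p hp).2.1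
  add := fun p hp s t => by
    obtain ⟨h0, hm, htr, -⟩ := hΦ.2 p hp
    have := (hΦ.2 (Φ t p) (hm t)).2.2.2 (fun s => Φ (s + t) p) (by simp) (fun s => hm _)
      (fun s _ => HasDerivAt.comp_add_const (f := fun u => Φ u p) s t (htr (s + t) (mem_univ _)))
    exact congrFun this s
  vel := fun p hp t =>
    ⟨_, hamField_ne_zero hh ((hΦ.2 p hp).2.1 t), (hΦ.2 p hp).2.2.1 t (mem_univ _)⟩

lemma absPeriodic_iff {d : ℕ} {Φ : ℝ → Phase d → Phase d} (H : GoodFlow (Tprime d) Φ)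
    (T : ℝ) (p : Phase d) : AbsPeriodic Φ T p ↔ AP (Tprime d) Φ T p := by
  have hbd : ∀ q, ‖Φ T q - q‖ ^ 2 ≤ periodDefect Φ T q ∧
      periodDefect Φ T q ≤ (2 * d) * ‖Φ T q - q‖ ^ 2 := fun q => sum_sq_bound (Φ T q - q)
  have hsm : ∀ z : ℝ × Phase d, z ∈ Prod.snd ⁻¹' (Tprime d) →
      ContDiffAt ℝ (⊤ : ℕ∞) (fun z : ℝ × Phase d => periodDefect Φ z.1 z.2) z := by
    intro z hz
    have hu : ContDiffAt ℝ (⊤ : ℕ∞) (fun z : ℝ × Phase d => Φ z.1 z.2 - z.2) z := H.smooth_u z hz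
    have h1 : ∀ j, ContDiffAt ℝ (⊤ : ℕ∞)
        (fun z : ℝ × Phase d => (Φ z.1 z.2 - z.2).1 j) z := fun j =>
      contDiffAt_pi.1 (contDiffAt_fst.comp z hu) j
    have h2 : ∀ j, ContDiffAt ℝ (⊤ : ℕ∞)
        (fun z : ℝ × Phase d => (Φ z.1 z.2 - z.2).2 j) z := fun j =>
      contDiffAt_pi.1 (contDiffAt_snd.comp z hu) j
    exact (ContDiffAt.sum fun j _ => (h1 j).pow 2).add (ContDiffAt.sum fun j _ => (h2 j).pow 2)
  constructor
  · rintro ⟨hp, hz⟩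
    refine ⟨hp, fun N => ?_⟩
    have hz' : ∀ n, iteratedFDeriv ℝ n (periodDefect Φ T) p = 0 := fun n => by
      rw [← iteratedFDerivWithin_of_isOpen n (isOpen_Tprime d) hp]; exact hz n
    have hfl := flat_of_jet (f := periodDefect Φ) ((isOpen_Tprime d).preimage continuous_snd)
      hsm (t := T) (p := p) hp hz' (N * 2)
    have h2 : (fun q => ‖Φ T q - q‖ ^ 2) =O[𝓝 p] fun q => (‖q - p‖ ^ N) ^ 2 := by
      simp only [← pow_mul]
      refine (Asymptotics.IsBigO.of_bound 1 (Eventually.of_forall fun q => ?_)).trans hfl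
      rw [one_mul, Real.norm_of_nonneg (by positivity)]
      exact (hbd q).1.trans (le_abs_self _)
    obtain ⟨C, hC, h3⟩ := h2.exists_pos
    refine Asymptotics.IsBigO.of_bound (Real.sqrt C) ?_
    filter_upwards [h3.bound] with q hq
    rw [Real.norm_of_nonneg (by positivity), Real.norm_of_nonneg (by positivity)] at hq
    rw [Real.norm_of_nonneg (by positivity)]
    refine abs_le_of_sq_le_sq' ?_ (by positivity) |>.2
    rw [mul_pow, Real.sq_sqrt hC.le]
    exact hq
  · rintro ⟨hp, hf⟩
    refine ⟨hp, fun n => ?_⟩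
    rw [iteratedFDerivWithin_of_isOpen n (isOpen_Tprime d) hp]
    refine FlatO.jet (contDiffAt_slice (f := periodDefect Φ) (z := (T, p)) (hsm (T, p) hp)) ?_ n
    have hsq : FlatO (fun q => ‖Φ T q - q‖ ^ 2) p := by
      intro N
      have h1 := (hf N).norm_left.mul (hf 0).norm_left
      simpa [sq] using h1
    intro N
    refine (Asymptotics.IsBigO.of_bound (2 * d) (Eventually.of_forall fun q => ?_)).trans (hsq N)
    have h0 : 0 ≤ periodDefect Φ T q := (sq_nonneg _).trans (hbd q).1
    rw [Real.norm_of_nonneg h0, Real.norm_of_nonneg (by positivity)]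
    exact (hbd q).2

/-- Lemma 4.2: for a quasianalytic homogeneous Hamiltonian with complete flow, a
path-connected subset `Ω` of the set `Π^a` of absolutely periodic points is either disjoint
from `Π^a_T` or entirely contained in it, for every `T > 0`. -/
theorem pathConnected_absPeriodic_dichotomy {d : ℕ}
    (m : ℕ → ℝ) (hm : RegularSeq m)
    (hqa : ¬ Summable (fun n : ℕ => (m (n + 1)) ^ (-(1 : ℝ) / (n + 1 : ℝ))))
    (h : Phase d → ℝ) (hh : HomHamiltonian h)
    (hhC : ∀ D : Set (Phase d), IsOpen D → IsCompact (closure D) → closure D ⊆ Tprime d →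
      CarlemanClass m D h)
    (Φ : ℝ → Phase d → Phase d) (hΦ : IsCompleteFlow h Φ)
    (Ω : Set (Phase d))
    (hΩsub : Ω ⊆ {p : Phase d | ∃ T : ℝ, 0 < T ∧ AbsPeriodic Φ T p})
    (hΩconn : ∀ p ∈ Ω, ∀ q ∈ Ω, JoinedIn Ω p q) :
    ∀ T : ℝ, 0 < T →
      Ω ∩ {p : Phase d | AbsPeriodic Φ T p} = ∅ ∨
      Ω ⊆ {p : Phase d | AbsPeriodic Φ T p} := by
  intro T _
  have H := goodFlow hh hΦ
  by_cases hne : Ω ∩ {p : Phase d | AbsPeriodic Φ T p} = ∅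
  · exact Or.inl hne
  right
  obtain ⟨p, hpΩ, hp⟩ := Set.nonempty_iff_ne_empty.2 hne
  have hp : AbsPeriodic Φ T p := hp
  intro q hq
  obtain ⟨γ, hγ⟩ := hΩconn p hpΩ q hq
  have hper : ∀ s : ℝ, ∃ T, 0 < T ∧ AP (Tprime d) Φ T (γ.extend s) := by
    intro s
    have hs : γ.extend s ∈ Ω := hγ _
    obtain ⟨T', hT', hap⟩ := hΩsub hs
    exact ⟨T', hT', (absPeriodic_iff H T' _).1 hap⟩
  have hm := H.main (γ := γ.extend) γ.continuous_extend hper (T := T) (a := 0) (b := 1)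
    (by rw [γ.extend_zero]; exact (absPeriodic_iff H T p).1 hp)
  rw [γ.extend_one] at hm
  exact (absPeriodic_iff H T q).2 hm
end
end
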